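/- (Corollary 8.1) Let γ ≥ 1, and let (ρ, u, v) be real-analytic on W × (−T, T) ⊂ ℝ² × ℝ with ρ > 0, satisfying the two-dimensional compressible Euler equations with pressure p := ρ^γ/γ: ∂₁(ρu² + p) + ∂₂(ρuv) = −∂_t(ρu), ∂₁(ρuv) + ∂₂(ρv² + p) = −∂_t(ρv), ∂₁(ρu) + ∂₂(ρv) = −∂_t ρ, and suppose ρ(x₀,0)·u(x₀,0)·v(x₀,0) ≠ 0 for some x₀ ∈ W. Then there exist a neighborhood W′ of x₀, a time T′ ∈ (0, T], and real-analytic functions g₁₁, g₁₂, g₂₂ on W′ × (−T′, T′) with det g := g₁₁g₂₂ − g₁₂² > 0 such that for every t ∈ (−T′, T′), the triple L := ρv² + p, M := −ρuv, N := ρu² + p together with the metric g(·, t) satisfies the Gauss–Codazzi equations; in particular, the Gauss curvature of g(·,t) equals κ = p² + pρ(u² + v²). -/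

import Mathlib

noncomputable def pdx1 (f : ℝ × ℝ × ℝ → ℝ) (q : ℝ × ℝ × ℝ) : ℝ :=
  deriv (fun s => f (s, q.2.1, q.2.2)) q.1

noncomputable def pdx2 (f : ℝ × ℝ × ℝ → ℝ) (q : ℝ × ℝ × ℝ) : ℝ :=
  deriv (fun s => f (q.1, s, q.2.2)) q.2.1

noncomputable def pdt (f : ℝ × ℝ × ℝ → ℝ) (q : ℝ × ℝ × ℝ) : ℝ :=
  deriv (fun s => f (q.1, q.2.1, s)) q.2.2

/-- Determinant of the metric `g₁₁g₂₂ - g₁₂²`. -/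
noncomputable def detg (g11 g12 g22 : ℝ × ℝ × ℝ → ℝ) (q : ℝ × ℝ × ℝ) : ℝ :=
  g11 q * g22 q - (g12 q) ^ 2

/-- Christoffel symbol Γ¹₁₁. -/
noncomputable def Gamma1_11 (g11 g12 g22 : ℝ × ℝ × ℝ → ℝ) (q : ℝ × ℝ × ℝ) : ℝ :=
  (g22 q * pdx1 g11 q - g12 q * (2 * pdx1 g12 q - pdx2 g11 q)) / (2 * detg g11 g12 g22 q)

/-- Christoffel symbol Γ¹₁₂. -/
noncomputable def Gamma1_12 (g11 g12 g22 : ℝ × ℝ × ℝ → ℝ) (q : ℝ × ℝ × ℝ) : ℝ :=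
  (g22 q * pdx2 g11 q - g12 q * pdx1 g22 q) / (2 * detg g11 g12 g22 q)

/-- Christoffel symbol Γ¹₂₂. -/
noncomputable def Gamma1_22 (g11 g12 g22 : ℝ × ℝ × ℝ → ℝ) (q : ℝ × ℝ × ℝ) : ℝ :=
  (g22 q * (2 * pdx2 g12 q - pdx1 g22 q) - g12 q * pdx2 g22 q) / (2 * detg g11 g12 g22 q)

/-- Christoffel symbol Γ²₁₁. -/
noncomputable def Gamma2_11 (g11 g12 g22 : ℝ × ℝ × ℝ → ℝ) (q : ℝ × ℝ × ℝ) : ℝ :=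
  (-(g12 q) * pdx1 g11 q + g11 q * (2 * pdx1 g12 q - pdx2 g11 q)) / (2 * detg g11 g12 g22 q)

/-- Christoffel symbol Γ²₁₂. -/
noncomputable def Gamma2_12 (g11 g12 g22 : ℝ × ℝ × ℝ → ℝ) (q : ℝ × ℝ × ℝ) : ℝ :=
  (-(g12 q) * pdx2 g11 q + g11 q * pdx1 g22 q) / (2 * detg g11 g12 g22 q)

/-- Christoffel symbol Γ²₂₂. -/
noncomputable def Gamma2_22 (g11 g12 g22 : ℝ × ℝ × ℝ → ℝ) (q : ℝ × ℝ × ℝ) : ℝ :=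
  (-(g12 q) * (2 * pdx2 g12 q - pdx1 g22 q) + g11 q * pdx2 g22 q) / (2 * detg g11 g12 g22 q)

/-- Gauss curvature of `g` via the Brioschi formula (spatial derivatives). -/
noncomputable def brioschi (g11 g12 g22 : ℝ × ℝ × ℝ → ℝ) (q : ℝ × ℝ × ℝ) : ℝ :=
  (1 / (2 * (detg g11 g12 g22 q) ^ 2)) *
    Matrix.det !![-(pdx2 (pdx2 g11) q) + 2 * pdx1 (pdx2 g12) q - pdx1 (pdx1 g22) q,
                    pdx1 g11 q, 2 * pdx1 g12 q - pdx2 g11 q;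
                  2 * pdx2 g12 q - pdx1 g22 q, 2 * g11 q, 2 * g12 q;
                  pdx2 g22 q, 2 * g12 q, 2 * g22 q]
  - (1 / (2 * (detg g11 g12 g22 q) ^ 2)) *
    Matrix.det !![0, pdx2 g11 q, pdx1 g22 q;
                  pdx2 g11 q, 2 * g11 q, 2 * g12 q;
                  pdx1 g22 q, 2 * g12 q, 2 * g22 q]

/-- The Gauss–Codazzi equations for `(L, M, N)` and the metric `g` at the point `q`. -/
def GaussCodazzi (L M N g11 g12 g22 : ℝ × ℝ × ℝ → ℝ) (q : ℝ × ℝ × ℝ) : Prop :=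
  pdx1 N q - pdx2 M q =
    -(Gamma1_22 g11 g12 g22 q) * L q + 2 * Gamma1_12 g11 g12 g22 q * M q
      - Gamma1_11 g11 g12 g22 q * N q ∧
  pdx1 M q - pdx2 L q =
    Gamma2_22 g11 g12 g22 q * L q - 2 * Gamma2_12 g11 g12 g22 q * M q
      + Gamma2_11 g11 g12 g22 q * N q ∧
  L q * N q - (M q) ^ 2 = brioschi g11 g12 g22 q

/-! ### A weighted `ℓ¹` Banach algebra of power series -/

/-- Normalised coefficient sequences: `c` represents
`∑ c (i,j,k) * choose (i+j) i * x^i y^j t^k`. -/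
def CKA : Type := lp (fun _ : ℕ × ℕ × ℕ => ℝ) 1

namespace CKA

noncomputable instance : NormedAddCommGroup CKA :=
  inferInstanceAs (NormedAddCommGroup (lp (fun _ : ℕ × ℕ × ℕ => ℝ) 1))
noncomputable instance : NormedSpace ℝ CKA :=
  inferInstanceAs (NormedSpace ℝ (lp (fun _ : ℕ × ℕ × ℕ => ℝ) 1))
instance : CompleteSpace CKA :=
  inferInstanceAs (CompleteSpace (lp (fun _ : ℕ × ℕ × ℕ => ℝ) 1))

/-- Coefficients. -/
def co (c : CKA) (m : ℕ × ℕ × ℕ) : ℝ := (show lp (fun _ : ℕ × ℕ × ℕ => ℝ) 1 from c).1 m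

/-- Basis vectors. -/
noncomputable def e (m : ℕ × ℕ × ℕ) : CKA :=
  (lp.single 1 m (1 : ℝ) : lp (fun _ : ℕ × ℕ × ℕ => ℝ) 1)

theorem hasSum_norm (c : CKA) : HasSum (fun m => ‖co c m‖) ‖c‖ := by
  have := lp.hasSum_norm (p := 1) (by simp) (show lp (fun _ : ℕ × ℕ × ℕ => ℝ) 1 from c)
  simp only [ENNReal.toReal_one, Real.rpow_one] at this
  exact this

theorem norm_e (m : ℕ × ℕ × ℕ) : ‖e m‖ = 1 := by
  have := lp.norm_single (p := 1) (E := fun _ : ℕ × ℕ × ℕ => ℝ) (by simp) m (1 : ℝ)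
  rw [norm_one] at this
  exact this

theorem co_e (m n : ℕ × ℕ × ℕ) : co (e m) n = if n = m then 1 else 0 := by
  have := lp.single_apply (E := fun _ : ℕ × ℕ × ℕ => ℝ) 1 m (1 : ℝ) n
  rw [Pi.single_apply] at this
  exact this

theorem co_add (c d : CKA) (m) : co (c + d) m = co c m + co d m := rfl
theorem co_smul (a : ℝ) (c : CKA) (m) : co (a • c) m = a * co c m := rfl

theorem hasSum_e (c : CKA) : HasSum (fun m => co c m • e m) c := by
  have := lp.hasSum_single (p := 1) (by simp) (show lp (fun _ : ℕ × ℕ × ℕ => ℝ) 1 from c)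
  refine this.congr_fun ?_ |> fun h => h
  intro m
  have h2 := lp.single_smul (E := fun _ : ℕ × ℕ × ℕ => ℝ) 1 m (co c m) (1 : ℝ)
  rw [smul_eq_mul, mul_one] at h2
  exact h2.symm

theorem clm_ext {E : Type*} [NormedAddCommGroup E] [NormedSpace ℝ E] {f g : CKA →L[ℝ] E}
    (h : ∀ m, f (e m) = g (e m)) : f = g := by
  ext c
  have h1 := f.hasSum (hasSum_e c)
  have h2 := g.hasSum (hasSum_e c)
  simp only [map_smul] at h1 h2
  simp only [h] at h1
  exact h1.unique h2

section lft
variable {E : Type*} [NormedAddCommGroup E] [NormedSpace ℝ E] [CompleteSpace E]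

theorem summable_lft (v : ℕ × ℕ × ℕ → E) (hv : ∀ m, ‖v m‖ ≤ 1) (c : CKA) :
    Summable (fun m => co c m • v m) := by
  refine Summable.of_norm_bounded (hasSum_norm c).summable (fun m => ?_)
  rw [norm_smul]
  exact mul_le_of_le_one_right (norm_nonneg _) (hv m)

/-- The bounded linear map with prescribed (bounded) values on the basis. -/
noncomputable def lft (v : ℕ × ℕ × ℕ → E) (hv : ∀ m, ‖v m‖ ≤ 1) : CKA →L[ℝ] E :=
  LinearMap.mkContinuous
    { toFun := fun c => ∑' m, co c m • v m
      map_add' := fun c d => by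
        rw [← (summable_lft v hv c).tsum_add (summable_lft v hv d)]
        simp only [co_add, add_smul]
      map_smul' := fun a c => by
        simp only [co_smul, mul_smul, RingHom.id_apply]
        rw [(summable_lft v hv c).tsum_const_smul] } 1 (fun c => by
      rw [one_mul]
      refine tsum_of_norm_bounded (hasSum_norm c) (fun m => ?_)
      rw [norm_smul]
      exact mul_le_of_le_one_right (norm_nonneg _) (hv m))

theorem lft_apply (v : ℕ × ℕ × ℕ → E) (hv : ∀ m, ‖v m‖ ≤ 1) (c : CKA) :
    lft v hv c = ∑' m, co c m • v m := rfl

theorem norm_lft (v : ℕ × ℕ × ℕ → E) (hv : ∀ m, ‖v m‖ ≤ 1) : ‖lft v hv‖ ≤ 1 :=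
  LinearMap.mkContinuous_norm_le _ zero_le_one _

@[simp] theorem lft_e (v : ℕ × ℕ × ℕ → E) (hv : ∀ m, ‖v m‖ ≤ 1) (m) : lft v hv (e m) = v m := by
  rw [lft_apply, tsum_eq_single m]
  · simp [co_e]
  · intro n hn
    simp [co_e, hn]
end lft

/-- The binomial weight. -/
def bw (m : ℕ × ℕ × ℕ) : ℝ := ((m.1 + m.2.1).choose m.1 : ℝ)

theorem bw_pos (m) : 0 < bw m := by
  unfold bw
  exact_mod_cast Nat.choose_pos (Nat.le_add_right _ _)

theorem bw_mul_le (m n) : bw m * bw n ≤ bw (m + n) := by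
  unfold bw
  have h := Nat.add_choose_eq (m.1 + m.2.1) (n.1 + n.2.1) (m.1 + n.1)
  have h2 : (m.1 + m.2.1).choose m.1 * (n.1 + n.2.1).choose n.1
      ≤ ((m.1 + m.2.1) + (n.1 + n.2.1)).choose (m.1 + n.1) := by
    rw [h]
    exact Finset.single_le_sum
      (f := fun ij : ℕ × ℕ => (m.1 + m.2.1).choose ij.1 * (n.1 + n.2.1).choose ij.2)
      (fun _ _ => Nat.zero_le _) (a := (m.1, n.1)) (by simp)
  have h3 : (m + n).1 + (m + n).2.1 = (m.1 + m.2.1) + (n.1 + n.2.1) := by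
    simp only [Prod.fst_add, Prod.snd_add]; ring
  rw [h3]
  exact_mod_cast h2

/-- Structure constants. -/
noncomputable def th (m n : ℕ × ℕ × ℕ) : ℝ := bw m * bw n / bw (m + n)

theorem th_nonneg (m n) : 0 ≤ th m n :=
  div_nonneg (mul_nonneg (bw_pos m).le (bw_pos n).le) (bw_pos _).le
theorem th_le (m n) : th m n ≤ 1 := (div_le_one (bw_pos _)).2 (bw_mul_le m n)

theorem norm_th (m n) : ‖th m n • e (m + n)‖ ≤ 1 := by
  rw [norm_smul, norm_e, mul_one, Real.norm_of_nonneg (th_nonneg m n)]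
  exact th_le m n

/-- Multiplication as a bilinear map. -/
noncomputable def mulL : CKA →L[ℝ] CKA →L[ℝ] CKA :=
  lft (fun m => lft (fun n => th m n • e (m + n)) (norm_th m)) (fun _ => norm_lft _ _)

theorem mulL_e (m n) : mulL (e m) (e n) = th m n • e (m + n) := by
  simp [mulL]

theorem mulL_norm (c d : CKA) : ‖mulL c d‖ ≤ ‖c‖ * ‖d‖ := by
  have h1 := mulL.le_opNorm c
  have h2 := (mulL c).le_opNorm d
  have h3 : ‖mulL‖ ≤ 1 := norm_lft _ _
  calc ‖mulL c d‖ ≤ ‖mulL c‖ * ‖d‖ := h2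
    _ ≤ (‖mulL‖ * ‖c‖) * ‖d‖ := by gcongr
    _ ≤ (1 * ‖c‖) * ‖d‖ := by gcongr
    _ = _ := by ring

theorem mulL_comm (c d : CKA) : mulL c d = mulL d c := by
  have : mulL = mulL.flip := by
    refine clm_ext fun m => clm_ext fun n => ?_
    rw [ContinuousLinearMap.flip_apply, mulL_e, mulL_e, add_comm n m]
    congr 1
    unfold th
    rw [mul_comm, add_comm]
  conv_lhs => rw [this]
  rfl

theorem mulL_assoc (a b c : CKA) : mulL (mulL a b) c = mulL a (mulL b c) := by
  have key : ∀ l m n, mulL (mulL (e l) (e m)) (e n) = mulL (e l) (mulL (e m) (e n)) := by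
    intro l m n
    simp only [mulL_e, map_smul, smul_apply, smul_smul, add_assoc]
    congr 1
    unfold th
    have := (bw_pos (l + m)).ne'
    have := (bw_pos (m + n)).ne'
    rw [add_assoc]
    field_simp
  have k2 : ∀ l m, ∀ c, mulL (mulL (e l) (e m)) c = mulL (e l) (mulL (e m) c) := by
    intro l m c
    have : mulL (mulL (e l) (e m)) = (mulL (e l)).comp (mulL (e m)) :=
      clm_ext fun n => key l m n
    rw [this]; rfl
  have k3 : ∀ l, ∀ b c, mulL (mulL (e l) b) c = mulL (e l) (mulL b c) := by
    intro l b c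
    have : (mulL.flip c).comp (mulL (e l)) = (mulL (e l)).comp (mulL.flip c) :=
      clm_ext fun n => k2 l n c
    exact congrArg (fun f : CKA →L[ℝ] CKA => f b) this
  have : (mulL.flip c).comp (mulL.flip b) = mulL.flip (mulL b c) :=
    clm_ext fun n => k3 n b c
  exact congrArg (fun f : CKA →L[ℝ] CKA => f a) this

theorem bw_zero : bw 0 = 1 := by simp [bw]

theorem one_mulL (c : CKA) : mulL (e 0) c = c := by
  have : mulL (e 0) = ContinuousLinearMap.id ℝ CKA := clm_ext fun n => by
    rw [mulL_e, th, bw_zero, zero_add, one_mul, div_self (bw_pos n).ne', one_smul]; rfl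
  rw [this]; rfl

noncomputable instance : CommRing CKA :=
  { (inferInstance : AddCommGroup CKA) with
    mul := fun a b => mulL a b
    one := e 0
    mul_assoc := mulL_assoc
    mul_comm := mulL_comm
    one_mul := one_mulL
    mul_one := fun a => (mulL_comm a (e 0)).trans (one_mulL a)
    left_distrib := fun a b c => (mulL a).map_add b c
    right_distrib := fun a b c => by
      change mulL (a + b) c = mulL a c + mulL b c
      rw [map_add]; rfl
    zero_mul := fun a => by change mulL 0 a = 0; rw [map_zero]; rfl
    mul_zero := fun a => (mulL a).map_zero }

theorem mul_def (a b : CKA) : a * b = mulL a b := rfl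
theorem one_def : (1 : CKA) = e 0 := rfl

noncomputable instance : NormedCommRing CKA :=
  { (inferInstance : NormedAddCommGroup CKA), (inferInstance : CommRing CKA) with
    norm_mul_le := mulL_norm }

instance : NormOneClass CKA := ⟨norm_e 0⟩

noncomputable instance : Algebra ℝ CKA :=
  Algebra.ofModule (fun r a b => by
      change mulL (r • a) b = r • mulL a b
      rw [map_smul]; rfl)
    (fun r a b => (mulL a).map_smul r b)

noncomputable instance : NormedAlgebra ℝ CKA :=
  { (inferInstance : Algebra ℝ CKA) with
    norm_smul_le := fun r a => norm_smul_le r a }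

/-! Evaluation -/

/-- Normalised monomials. -/
def ph (m : ℕ × ℕ × ℕ) (q : ℝ × ℝ × ℝ) : ℝ := bw m * q.1 ^ m.1 * q.2.1 ^ m.2.1 * q.2.2 ^ m.2.2

/-- The domain of convergence. -/
def dom : Set (ℝ × ℝ × ℝ) := {q | |q.1| + |q.2.1| < 1 ∧ |q.2.2| < 1}

theorem ph_le (m) {q} (hq : q ∈ dom) : ‖ph m q‖ ≤ 1 := by
  obtain ⟨h1, h2⟩ := hq
  have h3 : bw m * |q.1| ^ m.1 * |q.2.1| ^ m.2.1 ≤ (|q.1| + |q.2.1|) ^ (m.1 + m.2.1) := by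
    rw [add_pow]
    refine le_trans (le_of_eq ?_) (Finset.single_le_sum (f := fun l => |q.1| ^ l *
      |q.2.1| ^ (m.1 + m.2.1 - l) * ((m.1 + m.2.1).choose l : ℝ)) (fun _ _ => by positivity)
      (a := m.1) (by simp))
    simp only [Nat.add_sub_cancel_left, bw]
    ring
  have h4 : (|q.1| + |q.2.1|) ^ (m.1 + m.2.1) ≤ 1 := pow_le_one₀ (by positivity) h1.le
  have h5 : |q.2.2| ^ m.2.2 ≤ 1 := pow_le_one₀ (by positivity) h2.le
  rw [ph, norm_mul, norm_mul, norm_mul, norm_pow, norm_pow, norm_pow,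
    Real.norm_of_nonneg (bw_pos m).le]
  simp only [Real.norm_eq_abs]
  exact mul_le_one₀ (h3.trans h4) (by positivity) h5

/-- Evaluation of the series. -/
noncomputable def E (c : CKA) (q : ℝ × ℝ × ℝ) : ℝ := ∑' m, co c m * ph m q

/-- Evaluation as a bounded functional. -/
noncomputable def evL (q) (hq : q ∈ dom) : CKA →L[ℝ] ℝ := lft (fun m => ph m q) (fun m => ph_le m hq)

theorem evL_apply (q) (hq : q ∈ dom) (c) : evL q hq c = E c q := rfl

theorem evL_mul (q) (hq : q ∈ dom) (c d : CKA) : evL q hq (c * d) = evL q hq c * evL q hq d := by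
  have : (ContinuousLinearMap.compL ℝ CKA CKA ℝ (evL q hq)).comp mulL
      = (((ContinuousLinearMap.mul ℝ ℝ).comp (evL q hq)).flip.comp (evL q hq)).flip := by
    refine clm_ext fun m => clm_ext fun n => ?_
    simp only [ContinuousLinearMap.comp_apply, ContinuousLinearMap.compL_apply,
      ContinuousLinearMap.flip_apply, mulL_e, ContinuousLinearMap.mul_apply', map_smul]
    simp only [evL, lft_e, smul_eq_mul, ph, th, Prod.fst_add, Prod.snd_add, pow_add]
    have := (bw_pos (m + n)).ne'
    field_simp
  exact congrArg (fun f : CKA →L[ℝ] CKA →L[ℝ] ℝ => f c d) this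

theorem evL_one (q) (hq : q ∈ dom) : evL q hq 1 = 1 := by
  rw [one_def]
  simp [evL, ph, bw_zero]

/-- Evaluation as an algebra homomorphism. -/
noncomputable def ev (q) (hq : q ∈ dom) : CKA →ₐ[ℝ] ℝ :=
  AlgHom.ofLinearMap (evL q hq).toLinearMap (evL_one q hq) (evL_mul q hq)

theorem ev_apply (q) (hq : q ∈ dom) (c) : ev q hq c = E c q := rfl

/-! The operators `J = ∂ₓ⁻¹` and `K = ∂ᵧ∂ₓ⁻¹` -/

noncomputable def J : CKA →L[ℝ] CKA :=
  lft (fun m => ((m.1 + m.2.1 + 1 : ℝ)⁻¹) • e (m.1 + 1, m.2.1, m.2.2)) (fun m => by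
    rw [norm_smul, norm_e, mul_one, Real.norm_of_nonneg (by positivity)]
    apply inv_le_one_of_one_le₀
    have : (0 : ℝ) ≤ m.1 + m.2.1 := by positivity
    linarith)

noncomputable def K : CKA →L[ℝ] CKA :=
  lft (fun m => if m.2.1 = 0 then 0 else e (m.1 + 1, m.2.1 - 1, m.2.2)) (fun m => by
    split_ifs
    · simp
    · rw [norm_e])

theorem KJ_comm (c : CKA) : K (J c) = J (K c) := by
  have : K.comp J = J.comp K := clm_ext fun m => by
    obtain ⟨i, j, k⟩ := m
    simp only [ContinuousLinearMap.comp_apply, J, K, lft_e, map_smul]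
    rcases j with _ | j
    · simp
    · simp only [Nat.add_eq_zero_iff, one_ne_zero, and_false, if_false, Nat.add_sub_cancel, lft_e]
      congr 1
      push_cast
      ring
  exact congrArg (fun f : CKA →L[ℝ] CKA => f c) this

theorem E_lft (v : ℕ × ℕ × ℕ → CKA) (hv : ∀ m, ‖v m‖ ≤ 1) (c : CKA) {q} (hq : q ∈ dom) :
    E (lft v hv c) q = ∑' m, co c m * E (v m) q := by
  rw [← evL_apply q hq, lft_apply, (evL q hq).map_tsum (summable_lft v hv c)]
  simp only [map_smul, smul_eq_mul, evL_apply]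

theorem E_e (m) {q} (hq : q ∈ dom) : E (e m) q = ph m q := by
  rw [← evL_apply q hq, evL, lft_e]

theorem E_smul (a : ℝ) (c : CKA) {q} (hq : q ∈ dom) : E (a • c) q = a * E c q := by
  rw [← evL_apply q hq, map_smul, smul_eq_mul, evL_apply]

theorem E_J (c : CKA) {q} (hq : q ∈ dom) :
    E (J c) q = ∑' m : ℕ × ℕ × ℕ,
      co c m * ((m.1 + m.2.1 + 1 : ℝ)⁻¹ * ph (m.1 + 1, m.2.1, m.2.2) q) := by
  rw [J, E_lft _ _ _ hq]
  congr 1; ext m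
  rw [E_smul _ _ hq, E_e _ hq]

theorem E_K (c : CKA) {q} (hq : q ∈ dom) :
    E (K c) q = ∑' m : ℕ × ℕ × ℕ,
      co c m * (if m.2.1 = 0 then 0 else ph (m.1 + 1, m.2.1 - 1, m.2.2) q) := by
  rw [K, E_lft _ _ _ hq]
  congr 1; ext m
  split_ifs
  · rw [← evL_apply q hq, map_zero]
  · rw [E_e _ hq]

theorem bw_succ (i j k : ℕ) : bw (i + 1, j, k) * (i + 1) = (i + j + 1) * bw (i, j, k) := by
  unfold bw
  have := Nat.add_one_mul_choose_eq (i + j) i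
  simp only
  rw [show i + 1 + j = i + j + 1 by ring]
  exact_mod_cast this.symm

theorem bw_succ' (i j k : ℕ) :
    bw (i + 1, j + 1, k) * (j + 1) = (i + j + 2) * bw (i + 1, j, k) := by
  unfold bw
  have := Nat.choose_mul_succ_eq (i + 1 + j) (i + 1)
  simp only
  rw [show i + 1 + (j + 1) = i + 1 + j + 1 by ring]
  rw [show i + 1 + j + 1 - (i + 1) = j + 1 by omega] at this
  have h : (((i + 1 + j).choose (i + 1) * (i + 1 + j + 1) : ℕ) : ℝ)
    = ((i + 1 + j + 1).choose (i + 1) * (j + 1) : ℕ) := by rw [this]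
  push_cast at h
  linarith

theorem dom_open : IsOpen dom := by
  apply IsOpen.and <;> apply isOpen_lt <;> fun_prop

theorem hasDeriv1_J (c : CKA) {q} (hq : q ∈ dom) :
    HasDerivAt (fun s => E (J c) (s, q.2.1, q.2.2)) (E c q) q.1 := by
  obtain ⟨h1, h2⟩ := id hq
  set t : Set ℝ := Metric.ball 0 (1 - |q.2.1|) with ht
  have hmem : ∀ s ∈ t, (s, q.2.1, q.2.2) ∈ dom := by
    intro s hs
    rw [ht, mem_ball_zero_iff, Real.norm_eq_abs] at hs
    exact ⟨by simp only; linarith, h2⟩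
  have hq1 : q.1 ∈ t := by rw [ht, mem_ball_zero_iff, Real.norm_eq_abs]; linarith
  have key := hasDerivAt_tsum_of_isPreconnected (t := t)
    (g := fun (m : ℕ × ℕ × ℕ) s => co c m * ((m.1 + m.2.1 + 1 : ℝ)⁻¹ *
      ph (m.1 + 1, m.2.1, m.2.2) (s, q.2.1, q.2.2)))
    (g' := fun m s => co c m * ph m (s, q.2.1, q.2.2)) (u := fun m => ‖co c m‖) (y₀ := q.1)
    (y := q.1)
    (hasSum_norm c).summable Metric.isOpen_ball (convex_ball _ _).isPreconnected ?_ ?_ hq1 ?_ hq1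
  · refine key.congr_of_eventuallyEq ?_
    filter_upwards [Metric.isOpen_ball.mem_nhds hq1] with s hs
    exact E_J c (hmem s hs)
  · rintro ⟨i, j, k⟩ s hs
    refine HasDerivAt.const_mul _ ?_
    have hb := bw_succ i j k
    have := (((hasDerivAt_pow (i + 1) s).const_mul (bw (i + 1, j, k))).mul_const
      (q.2.1 ^ j)).mul_const (q.2.2 ^ k) |>.const_mul ((i + j + 1 : ℝ)⁻¹)
    simp only [ph]
    convert this using 1
    simp only [Nat.add_sub_cancel]
    push_cast
    have h0 : (i + j + 1 : ℝ) ≠ 0 := by positivity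
    field_simp
    linear_combination (-(s ^ i * q.2.1 ^ j * q.2.2 ^ k)) * hb
  · intro m s hs
    rw [norm_mul]
    exact mul_le_of_le_one_right (norm_nonneg _) (ph_le m (hmem s hs))
  · refine Summable.of_norm_bounded (hasSum_norm c).summable (fun m => ?_)
    rw [norm_mul, norm_mul, Real.norm_of_nonneg (by positivity : (0:ℝ) ≤ (m.1 + m.2.1 + 1 : ℝ)⁻¹)]
    refine mul_le_of_le_one_right (norm_nonneg _) ?_
    refine mul_le_one₀ ?_ (norm_nonneg _) (ph_le _ hq)
    apply inv_le_one_of_one_le₀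
    have : (0 : ℝ) ≤ m.1 + m.2.1 := by positivity
    linarith

theorem hasDeriv2_J (c : CKA) {q} (hq : q ∈ dom) :
    HasDerivAt (fun s => E (J c) (q.1, s, q.2.2)) (E (K c) q) q.2.1 := by
  obtain ⟨h1, h2⟩ := id hq
  set t : Set ℝ := Metric.ball 0 (1 - |q.1|) with ht
  have hmem : ∀ s ∈ t, (q.1, s, q.2.2) ∈ dom := by
    intro s hs
    rw [ht, mem_ball_zero_iff, Real.norm_eq_abs] at hs
    exact ⟨by simp only; linarith, h2⟩
  have hq1 : q.2.1 ∈ t := by rw [ht, mem_ball_zero_iff, Real.norm_eq_abs]; linarith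
  have key := hasDerivAt_tsum_of_isPreconnected (t := t)
    (g := fun (m : ℕ × ℕ × ℕ) s => co c m * ((m.1 + m.2.1 + 1 : ℝ)⁻¹ *
      ph (m.1 + 1, m.2.1, m.2.2) (q.1, s, q.2.2)))
    (g' := fun m s => co c m *
      (if m.2.1 = 0 then 0 else ph (m.1 + 1, m.2.1 - 1, m.2.2) (q.1, s, q.2.2)))
    (u := fun m => ‖co c m‖) (y₀ := q.2.1) (y := q.2.1)
    (hasSum_norm c).summable Metric.isOpen_ball (convex_ball _ _).isPreconnected ?_ ?_ hq1 ?_ hq1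
  · rw [E_K c hq]
    refine key.congr_of_eventuallyEq ?_
    filter_upwards [Metric.isOpen_ball.mem_nhds hq1] with s hs
    exact E_J c (hmem s hs)
  · rintro ⟨i, j, k⟩ s hs
    refine HasDerivAt.const_mul _ ?_
    simp only [ph]
    rcases j with _ | j
    · simpa using hasDerivAt_const s _
    have hb := bw_succ' i j k
    have := (((hasDerivAt_pow (j + 1) s).const_mul (bw (i + 1, j + 1, k) * q.1 ^ (i + 1)))).mul_const (q.2.2 ^ k) |>.const_mul ((i + (j + 1 : ℕ) + 1 : ℝ)⁻¹)
    convert this using 1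
    simp only [Nat.add_sub_cancel, Nat.add_eq_zero_iff, one_ne_zero, and_false, if_false]
    push_cast
    have h0 : (i + (j + 1) + 1 : ℝ) ≠ 0 := by positivity
    field_simp
    linear_combination (-(s ^ j * q.1 ^ (i + 1) * q.2.2 ^ k)) * hb
  · intro m s hs
    rw [norm_mul]
    refine mul_le_of_le_one_right (norm_nonneg _) ?_
    split_ifs
    · simp
    · exact ph_le _ (hmem s hs)
  · refine Summable.of_norm_bounded (hasSum_norm c).summable (fun m => ?_)
    rw [norm_mul, norm_mul, Real.norm_of_nonneg (by positivity : (0:ℝ) ≤ (m.1 + m.2.1 + 1 : ℝ)⁻¹)]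
    refine mul_le_of_le_one_right (norm_nonneg _) ?_
    refine mul_le_one₀ ?_ (norm_nonneg _) (ph_le _ hq)
    apply inv_le_one_of_one_le₀
    have : (0 : ℝ) ≤ m.1 + m.2.1 := by positivity
    linarith

end CKA

namespace CKA

noncomputable def S1 : CKA →L[ℝ] CKA :=
  lft (fun m => if m.1 = 0 then 0 else e (m.1 - 1, m.2.1, m.2.2)) (fun m => by
    split_ifs
    · simp
    · rw [norm_e])
noncomputable def S2 : CKA →L[ℝ] CKA :=
  lft (fun m => if m.2.1 = 0 then 0 else e (m.1, m.2.1 - 1, m.2.2)) (fun m => by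
    split_ifs
    · simp
    · rw [norm_e])
noncomputable def S3 : CKA →L[ℝ] CKA :=
  lft (fun m => if m.2.2 = 0 then 0 else e (m.1, m.2.1, m.2.2 - 1)) (fun m => by
    split_ifs
    · simp
    · rw [norm_e])

noncomputable def pi0 : CKA →L[ℝ] ℝ :=
  lft (fun m => if m = 0 then 1 else 0) (fun m => by split_ifs <;> simp)

theorem bw_le (m) : bw m ≤ 4 ^ (m.1 + m.2.1 + m.2.2) := by
  have h1 : (m.1 + m.2.1).choose m.1 ≤ 2 ^ (m.1 + m.2.1) := Nat.choose_le_two_pow _ _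
  have h2 : bw m ≤ 2 ^ (m.1 + m.2.1) := by unfold bw; exact_mod_cast h1
  refine h2.trans ?_
  calc (2 : ℝ) ^ (m.1 + m.2.1) ≤ 4 ^ (m.1 + m.2.1) := by gcongr; norm_num
    _ ≤ 4 ^ (m.1 + m.2.1 + m.2.2) := pow_le_pow_right₀ (by norm_num) (by omega)

noncomputable def R : CKA →L[ℝ] CKA :=
  lft (fun m => (bw m / 4 ^ (m.1 + m.2.1 + m.2.2)) • e m) (fun m => by
    rw [norm_smul, norm_e, mul_one, Real.norm_of_nonneg (div_nonneg (bw_pos m).le (by positivity))]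
    exact (div_le_one (by positivity)).2 (bw_le m))

noncomputable def B (q : ℝ × ℝ × ℝ) : CKA →L[ℝ] CKA :=
  (1 - (4 * q.2.2) • S3) * (1 - (4 * q.2.1) • S2) * (1 - (4 * q.1) • S1)

theorem E_eq_resolvent (c : CKA) (q : ℝ × ℝ × ℝ) (h1 : |q.1| < 1 / 4) (h2 : |q.2.1| < 1 / 4)
    (h3 : |q.2.2| < 1 / 4) (hB : IsUnit (B q)) : E c q = pi0 (Ring.inverse (B q) (R c)) := by
  have hq : q ∈ dom := ⟨by linarith, by linarith⟩
  have hb : ∀ m : ℕ × ℕ × ℕ, ‖(4 * q.1) ^ m.1 * (4 * q.2.1) ^ m.2.1 * (4 * q.2.2) ^ m.2.2‖ ≤ 1 := by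
    intro m
    rw [norm_mul, norm_mul, norm_pow, norm_pow, norm_pow]
    simp only [Real.norm_eq_abs, abs_mul, abs_of_pos (by norm_num : (0:ℝ) < 4)]
    refine mul_le_one₀ (mul_le_one₀ ?_ ?_ ?_) ?_ ?_
    all_goals first
      | positivity
      | exact pow_le_one₀ (by positivity) (by linarith)
  set chi := lft (fun m : ℕ × ℕ × ℕ =>
    (4 * q.1) ^ m.1 * (4 * q.2.1) ^ m.2.1 * (4 * q.2.2) ^ m.2.2) hb with hchi
  have hR : E c q = chi (R c) := by
    have : evL q hq = chi.comp R := clm_ext fun m => by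
      simp only [evL, ContinuousLinearMap.comp_apply, R, hchi, lft_e, map_smul, smul_eq_mul, ph,
        mul_pow, pow_add]
      field_simp
    rw [← evL_apply q hq, this]; rfl
  have hpi : chi.comp (B q) = pi0 := clm_ext fun m => by
    obtain ⟨i, j, k⟩ := m
    rcases i with _ | i <;> rcases j with _ | j <;> rcases k with _ | k <;>
    · simp [B, S1, S2, S3, pi0, hchi, pow_succ]
      try ring
  rw [hR, ← hpi]
  have : B q * Ring.inverse (B q) = 1 := Ring.mul_inverse_cancel _ hB
  have h5 := congrArg (fun f : CKA →L[ℝ] CKA => f (R c)) this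
  change chi (R c) = chi (B q (Ring.inverse (B q) (R c)))
  exact (congrArg chi h5).symm

theorem E_analyticAt (c : CKA) : AnalyticAt ℝ (E c) 0 := by
  have hB : AnalyticAt ℝ B 0 := by
    unfold B
    have a1 : AnalyticAt ℝ (fun q : ℝ × ℝ × ℝ => q.1) 0 := analyticAt_fst
    have a2 : AnalyticAt ℝ (fun q : ℝ × ℝ × ℝ => q.2.1) 0 := analyticAt_fst.fun_comp analyticAt_snd
    have a3 : AnalyticAt ℝ (fun q : ℝ × ℝ × ℝ => q.2.2) 0 := analyticAt_snd.fun_comp analyticAt_snd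
    refine AnalyticAt.mul (AnalyticAt.mul ?_ ?_) ?_
    · exact analyticAt_const.sub ((analyticAt_const.mul a3).smul analyticAt_const)
    · exact analyticAt_const.sub ((analyticAt_const.mul a2).smul analyticAt_const)
    · exact analyticAt_const.sub ((analyticAt_const.mul a1).smul analyticAt_const)
  have hB0 : B 0 = 1 := by
    unfold B
    simp only [Prod.fst_zero, Prod.snd_zero, mul_zero]
    rw [zero_smul ℝ S1, zero_smul ℝ S2, zero_smul ℝ S3, sub_zero, one_mul, one_mul]
  have hinv : AnalyticAt ℝ (fun q => Ring.inverse (B q)) 0 := by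
    have h := analyticAt_inverse (𝕜 := ℝ) (1 : (CKA →L[ℝ] CKA)ˣ)
    rw [Units.val_one, ← hB0] at h
    exact h.comp hB
  have hfin : AnalyticAt ℝ (fun q => pi0 (Ring.inverse (B q) (R c))) 0 :=
    ((pi0.comp (ContinuousLinearMap.apply ℝ CKA (R c))).analyticAt _).comp hinv
  refine hfin.congr ?_
  have hu : ∀ᶠ q in nhds (0 : ℝ × ℝ × ℝ), IsUnit (B q) := by
    have : B ⁻¹' {x | IsUnit x} ∈ nhds 0 := hB.continuousAt.preimage_mem_nhds (by
      rw [hB0]; exact Units.isOpen.mem_nhds isUnit_one)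
    exact this
  have hn : ∀ᶠ q in nhds (0 : ℝ × ℝ × ℝ), |q.1| < 1 / 4 ∧ |q.2.1| < 1 / 4 ∧ |q.2.2| < 1 / 4 := by
    have ho : IsOpen {q : ℝ × ℝ × ℝ | |q.1| < 1 / 4 ∧ |q.2.1| < 1 / 4 ∧ |q.2.2| < 1 / 4} := by
      apply IsOpen.and _ (IsOpen.and _ _) <;> apply isOpen_lt <;> fun_prop
    exact ho.mem_nhds (by simp)
  filter_upwards [hu, hn] with q h1 h2
  exact (E_eq_resolvent c q h2.1 h2.2.1 h2.2.2 h1).symm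

/-- The scaled coordinates as elements of the algebra. -/
noncomputable def Gs (s : ℝ) : Fin 3 → CKA :=
  ![s ^ 2 • e (1, 0, 0), s • e (0, 1, 0), s • e (0, 0, 1)]

def bas : Fin 3 → ℝ × ℝ × ℝ := ![(1, 0, 0), (0, 1, 0), (0, 0, 1)]

theorem norm_Gs {s s0 : ℝ} (hs : |s| ≤ s0) (h1 : s0 ≤ 1) (i : Fin 3) : ‖Gs s i‖ ≤ s0 := by
  have h2 : |s| ^ 2 ≤ s0 := by nlinarith [abs_nonneg s]
  fin_cases i <;> simp [Gs, norm_smul, norm_e] <;> first | assumption | simpa using h2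

theorem norm_bas (i : Fin 3) : ‖bas i‖ ≤ 1 := by
  fin_cases i <;> simp [bas, Prod.norm_def]

/-- Rescaled expansion of an analytic function in the algebra. -/
theorem expand (f : ℝ × ℝ × ℝ → ℝ) (q0 : ℝ × ℝ × ℝ) (hf : AnalyticAt ℝ f q0) :
    ∃ F : ℝ → CKA, Filter.Tendsto F (nhds 0) (nhds (algebraMap ℝ CKA (f q0))) ∧
      ∀ᶠ s in nhds (0 : ℝ), ∀ q ∈ dom,
        E (F s) q = f (q0 + (s ^ 2 * q.1, s * q.2.1, s * q.2.2)) := by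
  obtain ⟨p, r, hp⟩ := hf
  obtain ⟨r', hr0, hr'⟩ := ENNReal.lt_iff_exists_nnreal_btwn.1 hp.r_pos
  have hr0' : (0 : ℝ) < r' := by exact_mod_cast hr0
  have hsum := p.summable_norm_mul_pow (hr'.trans_le hp.r_le)
  set s0 : ℝ := min 1 ((r' : ℝ) / 3) / 2 with hs0
  have hm : 0 < min 1 ((r' : ℝ) / 3) := lt_min one_pos (by positivity)
  have hs0pos : 0 < s0 := by positivity
  have hs01 : s0 ≤ 1 := by
    have := min_le_left 1 ((r' : ℝ) / 3); rw [hs0]; linarith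
  have hs03 : 3 * s0 ≤ r' := by
    have := min_le_right 1 ((r' : ℝ) / 3); rw [hs0]; linarith
  have hs0r : s0 < r' := by linarith
  let term : ℕ → ℝ → CKA := fun n s =>
    ∑ σ : Fin n → Fin 3, p n (fun l => bas (σ l)) • ∏ l, Gs s (σ l)
  have hterm : ∀ n s, s ∈ Set.Icc (-s0) s0 → ‖term n s‖ ≤ ‖p n‖ * (r' : ℝ) ^ n := by
    intro n s hs
    have hs' : |s| ≤ s0 := abs_le.2 hs
    have : ∀ σ : Fin n → Fin 3, ‖p n (fun l => bas (σ l)) • ∏ l, Gs s (σ l)‖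
        ≤ ‖p n‖ * s0 ^ n := by
      intro σ
      rw [norm_smul]
      gcongr
      · refine ((p n).le_opNorm _).trans ?_
        refine mul_le_of_le_one_right (norm_nonneg _) ?_
        exact Finset.prod_le_one (fun _ _ => norm_nonneg _) (fun _ _ => norm_bas _)
      · refine (Finset.norm_prod_le _ _).trans ?_
        refine (Finset.prod_le_prod (fun _ _ => norm_nonneg _)
          (fun l _ => norm_Gs hs' hs01 (σ l))).trans ?_
        simp
    refine (norm_sum_le _ _).trans ((Finset.sum_le_sum (fun σ _ => this σ)).trans ?_)
    simp only [Finset.sum_const, Finset.card_univ, Fintype.card_fun, Fintype.card_fin, nsmul_eq_mul]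
    push_cast
    calc (3 : ℝ) ^ n * (‖p n‖ * s0 ^ n) = ‖p n‖ * (3 * s0) ^ n := by rw [mul_pow]; ring
      _ ≤ _ := by gcongr
  have hcont : ContinuousOn (fun s => ∑' n, term n s) (Set.Icc (-s0) s0) := by
    refine continuousOn_tsum (fun n => ?_) hsum hterm
    refine Continuous.continuousOn ?_
    refine continuous_finsetSum _ fun σ _ => Continuous.fun_const_smul ?_ _
    refine continuous_finsetProd _ fun l _ => ?_
    generalize σ l = i
    fin_cases i <;> simp [Gs] <;> fun_prop
  have hnb : Set.Icc (-s0) s0 ∈ nhds (0 : ℝ) := Icc_mem_nhds (by linarith) hs0pos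
  refine ⟨fun s => ∑' n, term n s, ?_, ?_⟩
  · have h1 := (hcont.continuousAt hnb).tendsto
    have h2 : ∑' n, term n 0 = algebraMap ℝ CKA (f q0) := by
      rw [tsum_eq_single 0]
      · have := hp.coeff_zero (fun l => bas (Fin.elim0 l))
        simp only [term, Finset.univ_unique, Finset.sum_singleton, Finset.univ_eq_empty,
          Finset.prod_empty]
        rw [Algebra.algebraMap_eq_smul_one, ← hp.coeff_zero]
      · intro n hn
        obtain ⟨n, rfl⟩ := Nat.exists_eq_succ_of_ne_zero hn
        refine Finset.sum_eq_zero fun σ _ => ?_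
        rw [Finset.prod_eq_zero (Finset.mem_univ 0), smul_zero]
        generalize σ 0 = i
        fin_cases i <;> simp [Gs]
    rwa [h2] at h1
  · filter_upwards [hnb] with s hs q hq
    have hs' : |s| ≤ s0 := abs_le.2 hs
    have hsm : Summable (fun n => term n s) :=
      Summable.of_norm_bounded hsum (fun n => hterm n s hs)
    rw [← evL_apply q hq, (evL q hq).map_tsum hsm]
    have hG : ∀ i, ev q hq (Gs s i) = ![s ^ 2 * q.1, s * q.2.1, s * q.2.2] i := by
      intro i
      fin_cases i <;> simp [Gs, ev_apply, E_e _ hq, ph, bw]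
    have hpt : (s ^ 2 * q.1, s * q.2.1, s * q.2.2)
        = ∑ i, ![s ^ 2 * q.1, s * q.2.1, s * q.2.2] i • bas i := by
      simp [Fin.sum_univ_three, bas]
    have hev : ∀ n, evL q hq (term n s)
        = p n (fun _ => (s ^ 2 * q.1, s * q.2.1, s * q.2.2)) := by
      intro n
      change ev q hq (term n s) = _
      simp only [term, map_sum, map_smul, map_prod, hG]
      rw [hpt, (p n).map_sum]
      refine Finset.sum_congr rfl fun σ _ => ?_
      rw [(p n).map_smul_univ (fun l => ![s ^ 2 * q.1, s * q.2.1, s * q.2.2] (σ l))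
        (fun l => bas (σ l))]
      rw [smul_eq_mul, smul_eq_mul, mul_comm]
    simp only [hev]
    refine (hp.hasSum ?_).tsum_eq
    have hq1 : |q.1| < 1 := by have := hq.1; have := abs_nonneg q.2.1; linarith
    have hq2 : |q.2.1| < 1 := by have := hq.1; have := abs_nonneg q.1; linarith
    have hss : |s| ^ 2 ≤ s0 := by nlinarith [abs_nonneg s]
    have hle : ‖((s ^ 2 * q.1, s * q.2.1, s * q.2.2) : ℝ × ℝ × ℝ)‖ ≤ s0 := by
      simp only [Prod.norm_def, norm_mul, norm_pow, Real.norm_eq_abs]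
      refine max_le ?_ (max_le ?_ ?_)
      · nlinarith [abs_nonneg q.1, sq_nonneg |s|]
      · nlinarith [abs_nonneg q.2.1, abs_nonneg s]
      · nlinarith [abs_nonneg q.2.2, abs_nonneg s, hq.2]
    have hlt : ‖((s ^ 2 * q.1, s * q.2.1, s * q.2.2) : ℝ × ℝ × ℝ)‖ < r' := hle.trans_lt hs0r
    rw [Metric.mem_eball, edist_zero_right]
    refine lt_trans ?_ hr'
    rw [← ofReal_norm, ← ENNReal.ofReal_coe_nnreal]
    exact (ENNReal.ofReal_lt_ofReal_iff hr0').2 hlt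

end CKA

/-- Solvability of a perturbed equation whose unperturbed version is affine with onto linear part. -/
theorem ck_implicit {P V : Type*} [NormedAddCommGroup P] [NormedSpace ℝ P] [CompleteSpace P]
    [NormedAddCommGroup V] [NormedSpace ℝ V] [CompleteSpace V]
    (F : P × V → V) (hF : ContDiff ℝ 1 F) (p0 : P) (T : V →L[ℝ] V)
    (hT : Function.Surjective T) (c : V) (h0 : ∀ z, F (p0, z) = T z + c) :
    ∀ᶠ p in nhds p0, ∃ z, F (p, z) = 0 := by
  obtain ⟨z0, hz0⟩ := hT (-c)
  have hstr : HasStrictFDerivAt F (fderiv ℝ F (p0, z0)) (p0, z0) :=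
    hF.contDiffAt.hasStrictFDerivAt one_ne_zero
  set F' := fderiv ℝ F (p0, z0) with hF'
  have hpart : ∀ z, F' (0, z) = T z := by
    have h1 : HasFDerivAt (fun z => F (p0, z)) (F'.comp (ContinuousLinearMap.inr ℝ P V)) z0 :=
      hstr.hasFDerivAt.comp z0 (hasFDerivAt_prodMk_right p0 z0)
    have h2 : HasFDerivAt (fun z => F (p0, z)) T z0 := by
      simp only [h0]
      exact T.hasFDerivAt.add_const c
    have := h1.unique h2
    intro z
    exact congrArg (fun f : V →L[ℝ] V => f z) this
  have hstr2 : HasStrictFDerivAt (fun x : P × V => (x.1, F x))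
      ((ContinuousLinearMap.fst ℝ P V).prod F') (p0, z0) := hasStrictFDerivAt_fst.prodMk hstr
  have hsurj : ((ContinuousLinearMap.fst ℝ P V).prod F').range = ⊤ := by
    rw [LinearMap.range_eq_top]
    rintro ⟨a, b⟩
    obtain ⟨z, hz⟩ := hT (b - F' (a, 0))
    refine ⟨(a, z), ?_⟩
    have : F' (a, z) = F' (a, 0) + F' (0, z) := by rw [← map_add]; simp
    simp [this, hpart, hz]
  have hmap := hstr2.map_nhds_eq_of_surj hsurj
  have hF0 : F (p0, z0) = 0 := by rw [h0, hz0]; simp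
  simp only [hF0] at hmap
  have hev : ∀ᶠ y in nhds (p0, (0 : V)), ∃ x : P × V, (x.1, F x) = y := by
    rw [← hmap, Filter.eventually_map]
    exact Filter.Eventually.of_forall (fun x => ⟨x, rfl⟩)
  have hc : Filter.Tendsto (fun p : P => (p, (0 : V))) (nhds p0) (nhds (p0, 0)) :=
    (Continuous.prodMk_left (0 : V)).tendsto p0
  filter_upwards [hc.eventually hev] with p ⟨x, hx⟩
  obtain ⟨h1, h2⟩ := Prod.mk.inj hx
  exact ⟨x.2, by rw [← h1]; exact h2⟩

/-! ### The polynomial form of the Gauss–Codazzi equations -/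

section poly
variable {R : Type*} [CommRing R]

def pE1 (k1 L M N a b c a1 b1 c1 a2 b2 c2 : R) : R :=
  2 * (a * c - b ^ 2) * k1 + L * (c * (2 * b2 - c1) - b * c2) - 2 * M * (c * a2 - b * c1)
    + N * (c * a1 - b * (2 * b1 - a2))

def pE2 (k2 L M N a b c a1 b1 c1 a2 b2 c2 : R) : R :=
  -2 * (a * c - b ^ 2) * k2 + L * (-b * (2 * b2 - c1) + a * c2) - 2 * M * (-b * a2 + a * c1)
    + N * (-b * a1 + a * (2 * b1 - a2))

/-- Formal `x₁`-derivative of `pE1`. -/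
def pD1 (k1 L M N k11 L1 M1 N1 a b c a1 b1 c1 a2 b2 c2 a11 b11 c11 a12 b12 c12 : R) : R :=
  2 * (a1 * c + a * c1 - 2 * b * b1) * k1 + 2 * (a * c - b ^ 2) * k11
    + L1 * (c * (2 * b2 - c1) - b * c2)
    + L * (c1 * (2 * b2 - c1) + c * (2 * b12 - c11) - b1 * c2 - b * c12)
    - 2 * M1 * (c * a2 - b * c1) - 2 * M * (c1 * a2 + c * a12 - b1 * c1 - b * c11)
    + N1 * (c * a1 - b * (2 * b1 - a2))
    + N * (c1 * a1 + c * a11 - b1 * (2 * b1 - a2) - b * (2 * b11 - a12))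

/-- Formal `x₁`-derivative of `pE2`. -/
def pD2 (k2 L M N k21 L1 M1 N1 a b c a1 b1 c1 a2 b2 c2 a11 b11 c11 a12 b12 c12 : R) : R :=
  -2 * (a1 * c + a * c1 - 2 * b * b1) * k2 - 2 * (a * c - b ^ 2) * k21
    + L1 * (-b * (2 * b2 - c1) + a * c2)
    + L * (-b1 * (2 * b2 - c1) - b * (2 * b12 - c11) + a1 * c2 + a * c12)
    - 2 * M1 * (-b * a2 + a * c1) - 2 * M * (-b1 * a2 - b * a12 + a1 * c1 + a * c11)
    + N1 * (-b * a1 + a * (2 * b1 - a2))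
    + N * (-b1 * a1 - b * a11 + a1 * (2 * b1 - a2) + a * (2 * b11 - a12))

/-- The Gauss equation. -/
def pG (k a b c a1 b1 c1 a2 b2 c2 a22 b12 c11 : R) : R :=
  (-a22 + 2 * b12 - c11) * (4 * (a * c - b ^ 2))
    - a1 * ((2 * b2 - c1) * (2 * c) - 2 * b * c2)
    + (2 * b1 - a2) * ((2 * b2 - c1) * (2 * b) - 2 * a * c2)
    + a2 * (a2 * (2 * c) - 2 * b * c1) - c1 * (a2 * (2 * b) - 2 * a * c1)
    - 2 * (a * c - b ^ 2) ^ 2 * k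

end poly

namespace CKA

/-- The coordinate `x` as an algebra element. -/
noncomputable def X : CKA := e (1, 0, 0)

/-- The nonlinear map whose zero gives the second `x₁`-derivatives of the metric.  The data are
`N M L N₁ M₁ L₁ k₁ k₂ k₁₁ k₂₁ κ β β' βᵧ β'ᵧ βᵧᵧ`. -/
noncomputable def FF (w : (ℝ × (Fin 16 → CKA)) × (CKA × CKA × CKA)) : CKA × CKA × CKA :=
  let s := w.1.1
  let d := w.1.2
  let y := w.2.1
  let z := w.2.2.1
  let u := w.2.2.2
  let a := 1 + s ^ 2 • (X * d 11) + s ^ 4 • J (J y)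
  let b := s ^ 2 • (X * d 12) + s ^ 4 • J (J z)
  let c := 1 + s ^ 4 • J (J u)
  let a1 := d 11 + s ^ 2 • J y
  let b1 := d 12 + s ^ 2 • J z
  let c1 := s ^ 2 • J u
  let a2 := s ^ 2 • (X * d 13) + s ^ 3 • J (K y)
  let b2 := s ^ 2 • (X * d 14) + s ^ 3 • J (K z)
  let c2 := s ^ 3 • J (K u)
  let a12 := d 13 + s • K y
  let b12 := d 14 + s • K z
  let c12 := s • K u
  let a22 := s ^ 2 • (X * d 15) + s ^ 2 • K (K y)
  (pD1 (d 6) (d 2) (d 1) (d 0) (d 8) (d 5) (d 4) (d 3) a b c a1 b1 c1 a2 b2 c2 y z u a12 b12 c12,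
   pD2 (d 7) (d 2) (d 1) (d 0) (d 9) (d 5) (d 4) (d 3) a b c a1 b1 c1 a2 b2 c2 y z u a12 b12 c12,
   pG (d 10) a b c a1 b1 c1 a2 b2 c2 a22 b12 u)

theorem contDiff_FF : ContDiff ℝ 1 FF := by
  unfold FF pD1 pD2 pG
  fun_prop

theorem ck_zero (r : Fin 16 → ℝ) (hr : r 0 ≠ 0) :
    ∀ᶠ p in nhds ((0 : ℝ), fun i => algebraMap ℝ CKA (r i)), ∃ z, FF (p, z) = 0 := by
  let f1 := ContinuousLinearMap.fst ℝ CKA (CKA × CKA)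
  let f2 := (ContinuousLinearMap.fst ℝ CKA CKA).comp (ContinuousLinearMap.snd ℝ CKA (CKA × CKA))
  let f3 := (ContinuousLinearMap.snd ℝ CKA CKA).comp (ContinuousLinearMap.snd ℝ CKA (CKA × CKA))
  let T : (CKA × CKA × CKA) →L[ℝ] (CKA × CKA × CKA) :=
    (r 0 • f1 - r 2 • f3).prod (((2 * r 0) • f2 - (2 * r 1) • f3).prod ((-4 : ℝ) • f3))
  have hT : ∀ y z u, T (y, z, u)
      = (r 0 • y - r 2 • u, (2 * r 0) • z - (2 * r 1) • u, (-4 : ℝ) • u) := fun y z u => rfl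
  refine ck_implicit FF contDiff_FF _ T ?_
    (FF (((0 : ℝ), fun i => algebraMap ℝ CKA (r i)), 0)) ?_
  · rintro ⟨y, z, u⟩
    refine ⟨((r 0)⁻¹ • (y + r 2 • ((-4 : ℝ)⁻¹ • u)),
      (2 * r 0)⁻¹ • (z + (2 * r 1) • ((-4 : ℝ)⁻¹ • u)), (-4 : ℝ)⁻¹ • u), ?_⟩
    rw [hT, smul_inv_smul₀ hr, smul_inv_smul₀ (mul_ne_zero two_ne_zero hr),
      smul_inv_smul₀ (by norm_num)]
    simp
  · rintro ⟨y, z, u⟩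
    rw [hT]
    simp only [FF, Prod.fst_zero, Prod.snd_zero, map_zero]
    simp only [ne_eq, OfNat.ofNat_ne_zero, not_false_eq_true, zero_pow, zero_smul, add_zero]
    simp only [Prod.mk_add_mk, Prod.mk.injEq, Algebra.smul_def, map_mul, map_neg, map_ofNat]
    refine ⟨?_, ?_, ?_⟩
    · unfold pD1; ring
    · unfold pD2; ring
    · unfold pG; ring

theorem ck_solve (f : Fin 16 → ℝ × ℝ × ℝ → ℝ) (q0 : ℝ × ℝ × ℝ) (hf : ∀ i, AnalyticAt ℝ (f i) q0)
    (h0 : f 0 q0 ≠ 0) :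
    ∃ s : ℝ, 0 < s ∧ ∃ y z u : CKA, ∃ d : Fin 16 → CKA,
      FF ((s, d), (y, z, u)) = 0 ∧
      ∀ i, ∀ q ∈ dom, E (d i) q = f i (q0 + (s ^ 2 * q.1, s * q.2.1, s * q.2.2)) := by
  choose F hF1 hF2 using fun i => expand (f i) q0 (hf i)
  have ht : Filter.Tendsto (fun s : ℝ => (s, fun i => F i s)) (nhds 0)
      (nhds ((0 : ℝ), fun i => algebraMap ℝ CKA (f i q0))) :=
    Filter.Tendsto.prodMk_nhds Filter.tendsto_id (tendsto_pi_nhds.2 hF1)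
  have h1 := ht.eventually (ck_zero (fun i => f i q0) h0)
  have h2 := Filter.eventually_all.2 hF2
  obtain ⟨s, hs, hs0⟩ := (((h1.and h2).filter_mono nhdsWithin_le_nhds).and
    (self_mem_nhdsWithin : Set.Ioi (0 : ℝ) ∈ nhdsWithin 0 (Set.Ioi 0))).exists
  obtain ⟨⟨⟨y, z, u⟩, hz⟩, h3⟩ := hs
  exact ⟨s, hs0, y, z, u, fun i => F i s, hz, h3⟩

end CKA

/-! ### Partial derivatives of analytic functions -/

theorem hasD1_of_analytic {f : ℝ × ℝ × ℝ → ℝ} {q : ℝ × ℝ × ℝ} (hf : AnalyticAt ℝ f q) :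
    HasDerivAt (fun s => f (s, q.2.1, q.2.2)) (fderiv ℝ f q (1, 0, 0)) q.1 := by
  have h1 : HasDerivAt (fun s : ℝ => (s, q.2.1, q.2.2)) (1, 0, 0) q.1 :=
    (hasDerivAt_id q.1).prodMk ((hasDerivAt_const _ _).prodMk (hasDerivAt_const _ _))
  exact HasFDerivAt.comp_hasDerivAt (l := f) q.1 hf.differentiableAt.hasFDerivAt h1

theorem hasD2_of_analytic {f : ℝ × ℝ × ℝ → ℝ} {q : ℝ × ℝ × ℝ} (hf : AnalyticAt ℝ f q) :
    HasDerivAt (fun s => f (q.1, s, q.2.2)) (fderiv ℝ f q (0, 1, 0)) q.2.1 := by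
  have h1 : HasDerivAt (fun s : ℝ => (q.1, s, q.2.2)) (0, 1, 0) q.2.1 :=
    (hasDerivAt_const _ _).prodMk ((hasDerivAt_id q.2.1).prodMk (hasDerivAt_const _ _))
  exact HasFDerivAt.comp_hasDerivAt (l := f) q.2.1 hf.differentiableAt.hasFDerivAt h1

theorem pdx1_hasDeriv {f : ℝ × ℝ × ℝ → ℝ} {q : ℝ × ℝ × ℝ} (hf : AnalyticAt ℝ f q) :
    HasDerivAt (fun s => f (s, q.2.1, q.2.2)) (pdx1 f q) q.1 :=
  (hasD1_of_analytic hf).differentiableAt.hasDerivAt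

theorem pdx2_hasDeriv {f : ℝ × ℝ × ℝ → ℝ} {q : ℝ × ℝ × ℝ} (hf : AnalyticAt ℝ f q) :
    HasDerivAt (fun s => f (q.1, s, q.2.2)) (pdx2 f q) q.2.1 :=
  (hasD2_of_analytic hf).differentiableAt.hasDerivAt

theorem pdx1_analytic {f : ℝ × ℝ × ℝ → ℝ} {q : ℝ × ℝ × ℝ} (hf : AnalyticAt ℝ f q) :
    AnalyticAt ℝ (pdx1 f) q := by
  have h : AnalyticAt ℝ (fun q => fderiv ℝ f q (1, 0, 0)) q :=
    ((ContinuousLinearMap.apply ℝ ℝ ((1, 0, 0) : ℝ × ℝ × ℝ)).analyticAt _).comp hf.fderiv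
  refine h.congr ?_
  filter_upwards [hf.eventually_analyticAt] with r hr
  exact (hasD1_of_analytic hr).deriv.symm

theorem pdx2_analytic {f : ℝ × ℝ × ℝ → ℝ} {q : ℝ × ℝ × ℝ} (hf : AnalyticAt ℝ f q) :
    AnalyticAt ℝ (pdx2 f) q := by
  have h : AnalyticAt ℝ (fun q => fderiv ℝ f q (0, 1, 0)) q :=
    ((ContinuousLinearMap.apply ℝ ℝ ((0, 1, 0) : ℝ × ℝ × ℝ)).analyticAt _).comp hf.fderiv
  refine h.congr ?_
  filter_upwards [hf.eventually_analyticAt] with r hr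
  exact (hasD2_of_analytic hr).deriv.symm

theorem pdx1_congr {f h : ℝ × ℝ × ℝ → ℝ} {U : Set (ℝ × ℝ × ℝ)} (hU : IsOpen U)
    (hfh : ∀ q ∈ U, f q = h q) {q} (hq : q ∈ U) : pdx1 f q = pdx1 h q := by
  refine Filter.EventuallyEq.deriv_eq ?_
  have hc : ContinuousAt (fun s : ℝ => (s, q.2.1, q.2.2)) q.1 := by fun_prop
  filter_upwards [hc.preimage_mem_nhds (hU.mem_nhds hq)] with s hs
  exact hfh _ hs

theorem pdx2_congr {f h : ℝ × ℝ × ℝ → ℝ} {U : Set (ℝ × ℝ × ℝ)} (hU : IsOpen U)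
    (hfh : ∀ q ∈ U, f q = h q) {q} (hq : q ∈ U) : pdx2 f q = pdx2 h q := by
  refine Filter.EventuallyEq.deriv_eq ?_
  have hc : ContinuousAt (fun s : ℝ => (q.1, s, q.2.2)) q.2.1 := by fun_prop
  filter_upwards [hc.preimage_mem_nhds (hU.mem_nhds hq)] with s hs
  exact hfh _ hs

theorem hasDeriv_pE1 {x : ℝ} {k L M N a b c a1 b1 c1 a2 b2 c2 : ℝ → ℝ}
    {k' L' M' N' a11 b11 c11 a12 b12 c12 : ℝ}
    (hk : HasDerivAt k k' x) (hL : HasDerivAt L L' x) (hM : HasDerivAt M M' x)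
    (hN : HasDerivAt N N' x) (ha : HasDerivAt a (a1 x) x) (hb : HasDerivAt b (b1 x) x)
    (hc : HasDerivAt c (c1 x) x) (ha1 : HasDerivAt a1 a11 x) (hb1 : HasDerivAt b1 b11 x)
    (hc1 : HasDerivAt c1 c11 x) (ha2 : HasDerivAt a2 a12 x) (hb2 : HasDerivAt b2 b12 x)
    (hc2 : HasDerivAt c2 c12 x) :
    HasDerivAt (fun x => pE1 (k x) (L x) (M x) (N x) (a x) (b x) (c x) (a1 x) (b1 x) (c1 x)
      (a2 x) (b2 x) (c2 x))
      (pD1 (k x) (L x) (M x) (N x) k' L' M' N' (a x) (b x) (c x) (a1 x) (b1 x) (c1 x)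
      (a2 x) (b2 x) (c2 x) a11 b11 c11 a12 b12 c12) x := by
  unfold pE1
  have h := (((((ha.fun_mul hc).fun_sub (hb.fun_pow 2)).const_mul 2).fun_mul hk).fun_add
    (hL.fun_mul ((hc.fun_mul ((hb2.const_mul 2).fun_sub hc1)).fun_sub (hb.fun_mul hc2)))).fun_sub
    ((hM.const_mul 2).fun_mul ((hc.fun_mul ha2).fun_sub (hb.fun_mul hc1))) |>.fun_add
    (hN.fun_mul ((hc.fun_mul ha1).fun_sub (hb.fun_mul ((hb1.const_mul 2).fun_sub ha2))))
  refine h.congr_deriv ?_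
  unfold pD1
  simp
  ring

theorem hasDeriv_pE2 {x : ℝ} {k L M N a b c a1 b1 c1 a2 b2 c2 : ℝ → ℝ}
    {k' L' M' N' a11 b11 c11 a12 b12 c12 : ℝ}
    (hk : HasDerivAt k k' x) (hL : HasDerivAt L L' x) (hM : HasDerivAt M M' x)
    (hN : HasDerivAt N N' x) (ha : HasDerivAt a (a1 x) x) (hb : HasDerivAt b (b1 x) x)
    (hc : HasDerivAt c (c1 x) x) (ha1 : HasDerivAt a1 a11 x) (hb1 : HasDerivAt b1 b11 x)
    (hc1 : HasDerivAt c1 c11 x) (ha2 : HasDerivAt a2 a12 x) (hb2 : HasDerivAt b2 b12 x)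
    (hc2 : HasDerivAt c2 c12 x) :
    HasDerivAt (fun x => pE2 (k x) (L x) (M x) (N x) (a x) (b x) (c x) (a1 x) (b1 x) (c1 x)
      (a2 x) (b2 x) (c2 x))
      (pD2 (k x) (L x) (M x) (N x) k' L' M' N' (a x) (b x) (c x) (a1 x) (b1 x) (c1 x)
      (a2 x) (b2 x) (c2 x) a11 b11 c11 a12 b12 c12) x := by
  unfold pE2
  have h := (((((ha.fun_mul hc).fun_sub (hb.fun_pow 2)).const_mul (-2)).fun_mul hk).fun_add
    (hL.fun_mul ((hb.fun_neg.fun_mul ((hb2.const_mul 2).fun_sub hc1)).fun_add (ha.fun_mul hc2)))).fun_sub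
    ((hM.const_mul 2).fun_mul ((hb.fun_neg.fun_mul ha2).fun_add (ha.fun_mul hc1))) |>.fun_add
    (hN.fun_mul ((hb.fun_neg.fun_mul ha1).fun_add (ha.fun_mul ((hb1.const_mul 2).fun_sub ha2))))
  refine h.congr_deriv ?_
  unfold pD2
  simp
  ring

namespace CKA

/-- Rescaling around a base point. -/
noncomputable def Sc (q0 : ℝ × ℝ × ℝ) (s : ℝ) (q : ℝ × ℝ × ℝ) : ℝ × ℝ × ℝ :=
  ((q.1 - q0.1) / s ^ 2, (q.2.1 - q0.2.1) / s, (q.2.2 - q0.2.2) / s)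

theorem Sc_analytic (q0 : ℝ × ℝ × ℝ) (s : ℝ) (q) : AnalyticAt ℝ (Sc q0 s) q := by
  have a1 : AnalyticAt ℝ (fun q : ℝ × ℝ × ℝ => q.1) q := analyticAt_fst
  have a2 : AnalyticAt ℝ (fun q : ℝ × ℝ × ℝ => q.2.1) q := analyticAt_fst.fun_comp analyticAt_snd
  have a3 : AnalyticAt ℝ (fun q : ℝ × ℝ × ℝ => q.2.2) q := analyticAt_snd.fun_comp analyticAt_snd
  unfold Sc
  simp only [div_eq_mul_inv]
  exact ((a1.fun_sub analyticAt_const).fun_mul analyticAt_const).prod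
    (((a2.fun_sub analyticAt_const).fun_mul analyticAt_const).prod
      ((a3.fun_sub analyticAt_const).fun_mul analyticAt_const))

theorem Sc_base (q0 : ℝ × ℝ × ℝ) (s : ℝ) : Sc q0 s q0 = 0 := by simp [Sc]

theorem Sc_inv (q0 : ℝ × ℝ × ℝ) {s : ℝ} (hs : 0 < s) (q) :
    q0 + (s ^ 2 * (Sc q0 s q).1, s * (Sc q0 s q).2.1, s * (Sc q0 s q).2.2) = q := by
  have := hs.ne'
  ext <;> simp only [Sc, Prod.fst_add, Prod.snd_add] <;> field_simp <;> ring

theorem ES_d1 (q0 : ℝ × ℝ × ℝ) (s : ℝ) (c : CKA) {q} (hq : Sc q0 s q ∈ dom) :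
    HasDerivAt (fun x => E (J c) (Sc q0 s (x, q.2.1, q.2.2))) (E c (Sc q0 s q) / s ^ 2) q.1 := by
  have h1 := hasDeriv1_J c hq
  have h2 : HasDerivAt (fun x : ℝ => (x - q0.1) / s ^ 2) (1 / s ^ 2) q.1 :=
    ((hasDerivAt_id q.1).sub_const _).div_const _
  have := HasDerivAt.comp (h₂ := fun x => E (J c) (x, (Sc q0 s q).2.1, (Sc q0 s q).2.2)) q.1 h1 h2
  rw [mul_one_div] at this
  exact this

theorem ES_d2 (q0 : ℝ × ℝ × ℝ) (s : ℝ) (c : CKA) {q} (hq : Sc q0 s q ∈ dom) :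
    HasDerivAt (fun x => E (J c) (Sc q0 s (q.1, x, q.2.2))) (E (K c) (Sc q0 s q) / s) q.2.1 := by
  have h1 := hasDeriv2_J c hq
  have h2 : HasDerivAt (fun x : ℝ => (x - q0.2.1) / s) (1 / s) q.2.1 :=
    ((hasDerivAt_id q.2.1).sub_const _).div_const _
  have := HasDerivAt.comp (h₂ := fun x => E (J c) ((Sc q0 s q).1, x, (Sc q0 s q).2.2)) q.2.1 h1 h2
  rw [mul_one_div] at this
  exact this

theorem E_J_zero (c : CKA) {q} (hq : q ∈ dom) (h : q.1 = 0) : E (J c) q = 0 := by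
  rw [E_J c hq]
  simp [ph, h]

section metric
variable (q0 : ℝ × ℝ × ℝ)

noncomputable def A0 (s : ℝ) (k : ℝ) (β : ℝ × ℝ × ℝ → ℝ) (Z : CKA) (q : ℝ × ℝ × ℝ) : ℝ :=
  k + (q.1 - q0.1) * β q + s ^ 4 * E (J (J Z)) (Sc q0 s q)
noncomputable def A1 (s : ℝ) (β : ℝ × ℝ × ℝ → ℝ) (Z : CKA) (q : ℝ × ℝ × ℝ) : ℝ :=
  β q + s ^ 2 * E (J Z) (Sc q0 s q)
noncomputable def A2 (s : ℝ) (βy : ℝ × ℝ × ℝ → ℝ) (Z : CKA) (q : ℝ × ℝ × ℝ) : ℝ :=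
  (q.1 - q0.1) * βy q + s ^ 3 * E (J (K Z)) (Sc q0 s q)
noncomputable def A12 (s : ℝ) (βy : ℝ × ℝ × ℝ → ℝ) (Z : CKA) (q : ℝ × ℝ × ℝ) : ℝ :=
  βy q + s * E (K Z) (Sc q0 s q)
noncomputable def A22 (s : ℝ) (βyy : ℝ × ℝ × ℝ → ℝ) (Z : CKA) (q : ℝ × ℝ × ℝ) : ℝ :=
  (q.1 - q0.1) * βyy q + s ^ 2 * E (K (K Z)) (Sc q0 s q)

theorem A0_d1 {s : ℝ} (hs : 0 < s) {β : ℝ × ℝ × ℝ → ℝ}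
    {q : ℝ × ℝ × ℝ} (hq : Sc q0 s q ∈ dom) (Z : CKA) (hβ : ∀ x y w, β (x, w) = β (y, w)) (k : ℝ) :
    HasDerivAt (fun x => A0 q0 s k β Z (x, q.2.1, q.2.2)) (A1 q0 s β Z q) q.1 := by
  have hb : HasDerivAt (fun x => β (x, q.2.1, q.2.2)) 0 q.1 := by
    simp only [fun x => hβ x q.1 (q.2.1, q.2.2)]
    exact hasDerivAt_const _ _
  have h := (((((hasDerivAt_id q.1).sub_const q0.1).fun_mul hb).const_add k)).fun_add
    ((ES_d1 q0 s (J Z) hq).const_mul (s ^ 4))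
  unfold A0 A1
  refine h.congr_deriv ?_
  have := hs.ne'
  field_simp
  simp

theorem A1_d1 {s : ℝ} (hs : 0 < s) {β : ℝ × ℝ × ℝ → ℝ}
    {q : ℝ × ℝ × ℝ} (hq : Sc q0 s q ∈ dom) (Z : CKA) (hβ : ∀ x y w, β (x, w) = β (y, w)) :
    HasDerivAt (fun x => A1 q0 s β Z (x, q.2.1, q.2.2)) (E Z (Sc q0 s q)) q.1 := by
  have hb : HasDerivAt (fun x => β (x, q.2.1, q.2.2)) 0 q.1 := by
    simp only [fun x => hβ x q.1 (q.2.1, q.2.2)]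
    exact hasDerivAt_const _ _
  have h := hb.fun_add ((ES_d1 q0 s Z hq).const_mul (s ^ 2))
  unfold A1
  refine h.congr_deriv ?_
  have := hs.ne'
  field_simp
  simp

theorem A2_d1 {s : ℝ} (hs : 0 < s) {β : ℝ × ℝ × ℝ → ℝ}
    {q : ℝ × ℝ × ℝ} (hq : Sc q0 s q ∈ dom) (Z : CKA) (hβ : ∀ x y w, β (x, w) = β (y, w)) :
    HasDerivAt (fun x => A2 q0 s β Z (x, q.2.1, q.2.2)) (A12 q0 s β Z q) q.1 := by
  have hb : HasDerivAt (fun x => β (x, q.2.1, q.2.2)) 0 q.1 := by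
    simp only [fun x => hβ x q.1 (q.2.1, q.2.2)]
    exact hasDerivAt_const _ _
  have h := ((((hasDerivAt_id q.1).sub_const q0.1).fun_mul hb)).fun_add
    ((ES_d1 q0 s (K Z) hq).const_mul (s ^ 3))
  unfold A2 A12
  refine h.congr_deriv ?_
  have := hs.ne'
  field_simp
  simp

theorem A0_d2 {s : ℝ} (hs : 0 < s) {β : ℝ × ℝ × ℝ → ℝ}
    {q : ℝ × ℝ × ℝ} (hq : Sc q0 s q ∈ dom) (Z : CKA) {βy : ℝ × ℝ × ℝ → ℝ}
    (hb : HasDerivAt (fun x => β (q.1, x, q.2.2)) (βy q) q.2.1) (k : ℝ) :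
    HasDerivAt (fun x => A0 q0 s k β Z (q.1, x, q.2.2)) (A2 q0 s βy Z q) q.2.1 := by
  have h := ((hb.const_mul (q.1 - q0.1)).const_add k).fun_add
    ((ES_d2 q0 s (J Z) hq).const_mul (s ^ 4))
  unfold A0 A2
  refine h.congr_deriv ?_
  have := hs.ne'
  rw [KJ_comm]
  field_simp

theorem A2_d2 {s : ℝ} (hs : 0 < s) {β : ℝ × ℝ × ℝ → ℝ}
    {q : ℝ × ℝ × ℝ} (hq : Sc q0 s q ∈ dom) (Z : CKA) {βy : ℝ × ℝ × ℝ → ℝ}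
    (hb : HasDerivAt (fun x => β (q.1, x, q.2.2)) (βy q) q.2.1) :
    HasDerivAt (fun x => A2 q0 s β Z (q.1, x, q.2.2)) (A22 q0 s βy Z q) q.2.1 := by
  have h := (hb.const_mul (q.1 - q0.1)).fun_add
    ((ES_d2 q0 s (K Z) hq).const_mul (s ^ 3))
  unfold A2 A22
  refine h.congr_deriv ?_
  have := hs.ne'
  field_simp

theorem A0_analytic (s : ℝ) {β : ℝ × ℝ × ℝ → ℝ} (Z : CKA)
    (hb : AnalyticAt ℝ β q0) (k : ℝ) : AnalyticAt ℝ (A0 q0 s k β Z) q0 := by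
  have hE : AnalyticAt ℝ (fun q => E (J (J Z)) (Sc q0 s q)) q0 := by
    have := E_analyticAt (J (J Z))
    rw [← Sc_base q0 s] at this
    exact this.fun_comp (Sc_analytic q0 s q0)
  exact (analyticAt_const.fun_add ((analyticAt_fst.fun_sub analyticAt_const).fun_mul hb)).fun_add
    (analyticAt_const.fun_mul hE)

end metric

end CKA

theorem map_pD1 {R S : Type*} [CommRing R] [CommRing S] (φ : R →+* S)
    (k1 L M N k11 L1 M1 N1 a b c a1 b1 c1 a2 b2 c2 a11 b11 c11 a12 b12 c12 : R) :
    φ (pD1 k1 L M N k11 L1 M1 N1 a b c a1 b1 c1 a2 b2 c2 a11 b11 c11 a12 b12 c12) =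
    pD1 (φ k1) (φ L) (φ M) (φ N) (φ k11) (φ L1) (φ M1) (φ N1) (φ a) (φ b) (φ c) (φ a1) (φ b1)
      (φ c1) (φ a2) (φ b2) (φ c2) (φ a11) (φ b11) (φ c11) (φ a12) (φ b12) (φ c12) := by
  simp only [pD1, map_add, map_sub, map_mul, map_neg, map_pow, map_ofNat]

theorem map_pD2 {R S : Type*} [CommRing R] [CommRing S] (φ : R →+* S)
    (k1 L M N k11 L1 M1 N1 a b c a1 b1 c1 a2 b2 c2 a11 b11 c11 a12 b12 c12 : R) :
    φ (pD2 k1 L M N k11 L1 M1 N1 a b c a1 b1 c1 a2 b2 c2 a11 b11 c11 a12 b12 c12) =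
    pD2 (φ k1) (φ L) (φ M) (φ N) (φ k11) (φ L1) (φ M1) (φ N1) (φ a) (φ b) (φ c) (φ a1) (φ b1)
      (φ c1) (φ a2) (φ b2) (φ c2) (φ a11) (φ b11) (φ c11) (φ a12) (φ b12) (φ c12) := by
  simp only [pD2, map_add, map_sub, map_mul, map_neg, map_pow, map_ofNat]

theorem map_pG {R S : Type*} [CommRing R] [CommRing S] (φ : R →+* S)
    (k a b c a1 b1 c1 a2 b2 c2 a22 b12 c11 : R) :
    φ (pG k a b c a1 b1 c1 a2 b2 c2 a22 b12 c11) =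
    pG (φ k) (φ a) (φ b) (φ c) (φ a1) (φ b1) (φ c1) (φ a2) (φ b2) (φ c2) (φ a22) (φ b12)
      (φ c11) := by
  simp only [pG, map_add, map_sub, map_mul, map_neg, map_pow, map_ofNat]

namespace CKA

theorem FF_ev (q0 : ℝ × ℝ × ℝ) {s : ℝ} (hs : 0 < s) (f : Fin 16 → ℝ × ℝ × ℝ → ℝ)
    (y z u : CKA) (d : Fin 16 → CKA) (h : FF ((s, d), (y, z, u)) = 0)
    (hd : ∀ i, ∀ q ∈ dom, E (d i) q = f i (q0 + (s ^ 2 * q.1, s * q.2.1, s * q.2.2)))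
    {q} (hq : Sc q0 s q ∈ dom) :
    pD1 (f 6 q) (f 2 q) (f 1 q) (f 0 q) (f 8 q) (f 5 q) (f 4 q) (f 3 q)
      (A0 q0 s 1 (f 11) y q) (A0 q0 s 0 (f 12) z q) (A0 q0 s 1 0 u q)
      (A1 q0 s (f 11) y q) (A1 q0 s (f 12) z q) (A1 q0 s 0 u q)
      (A2 q0 s (f 13) y q) (A2 q0 s (f 14) z q) (A2 q0 s 0 u q)
      (E y (Sc q0 s q)) (E z (Sc q0 s q)) (E u (Sc q0 s q))
      (A12 q0 s (f 13) y q) (A12 q0 s (f 14) z q) (A12 q0 s 0 u q) = 0 ∧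
    pD2 (f 7 q) (f 2 q) (f 1 q) (f 0 q) (f 9 q) (f 5 q) (f 4 q) (f 3 q)
      (A0 q0 s 1 (f 11) y q) (A0 q0 s 0 (f 12) z q) (A0 q0 s 1 0 u q)
      (A1 q0 s (f 11) y q) (A1 q0 s (f 12) z q) (A1 q0 s 0 u q)
      (A2 q0 s (f 13) y q) (A2 q0 s (f 14) z q) (A2 q0 s 0 u q)
      (E y (Sc q0 s q)) (E z (Sc q0 s q)) (E u (Sc q0 s q))
      (A12 q0 s (f 13) y q) (A12 q0 s (f 14) z q) (A12 q0 s 0 u q) = 0 ∧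
    pG (f 10 q)
      (A0 q0 s 1 (f 11) y q) (A0 q0 s 0 (f 12) z q) (A0 q0 s 1 0 u q)
      (A1 q0 s (f 11) y q) (A1 q0 s (f 12) z q) (A1 q0 s 0 u q)
      (A2 q0 s (f 13) y q) (A2 q0 s (f 14) z q) (A2 q0 s 0 u q)
      (A22 q0 s (f 15) y q) (A12 q0 s (f 14) z q) (E u (Sc q0 s q)) = 0 := by
  have hd' : ∀ i, ev _ hq (d i) = f i q := fun i => by
    rw [ev_apply, hd i _ hq, Sc_inv q0 hs]
  have hX : s ^ 2 * ev _ hq X = q.1 - q0.1 := by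
    rw [ev_apply, X, E_e _ hq]
    have := hs.ne'
    simp only [ph, bw, Sc]
    simp
    field_simp
  have hE : ∀ c, ev _ hq c = E c (Sc q0 s q) := fun c => ev_apply _ hq c
  have sm : ∀ (r : ℝ) (c : CKA), ev _ hq (r • c) = r * ev _ hq c := fun r c => by
    rw [map_smul, smul_eq_mul]
  have t : ∀ i, s ^ 2 * (ev _ hq X * f i q) = (q.1 - q0.1) * f i q := fun i => by
    rw [← mul_assoc, hX]
  have h1 := congrArg (fun w => (ev _ hq : CKA →+* ℝ) w.1) h
  have h2 := congrArg (fun w => (ev _ hq : CKA →+* ℝ) w.2.1) h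
  have h3 := congrArg (fun w => (ev _ hq : CKA →+* ℝ) w.2.2) h
  simp only [FF] at h1 h2 h3
  rw [map_pD1] at h1
  rw [map_pD2] at h2
  rw [map_pG] at h3
  simp only [RingHom.coe_coe, map_add, sm, map_mul, hd', map_one, t, Prod.fst_zero, Prod.snd_zero,
    map_zero] at h1 h2 h3
  simp only [hE] at h1 h2 h3
  simp only [A0, A1, A2, A12, A22, Pi.zero_apply, mul_zero, zero_add, add_zero]
  exact ⟨h1, h2, h3⟩

end CKA

theorem codazzi1_of {L M N g11 g12 g22 : ℝ × ℝ × ℝ → ℝ} {q : ℝ × ℝ × ℝ} {k a1 b1 c1 a2 b2 c2 : ℝ}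
    (hdet : 0 < detg g11 g12 g22 q)
    (h : pE1 k (L q) (M q) (N q) (g11 q) (g12 q) (g22 q) a1 b1 c1 a2 b2 c2 = 0)
    (ha1 : pdx1 g11 q = a1) (hb1 : pdx1 g12 q = b1) (hc1 : pdx1 g22 q = c1)
    (ha2 : pdx2 g11 q = a2) (hb2 : pdx2 g12 q = b2) (hc2 : pdx2 g22 q = c2) :
    k = -(Gamma1_22 g11 g12 g22 q) * L q + 2 * Gamma1_12 g11 g12 g22 q * M q
      - Gamma1_11 g11 g12 g22 q * N q := by
  have hd := hdet.ne'
  unfold Gamma1_22 Gamma1_12 Gamma1_11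
  rw [ha1, hb1, hc1, ha2, hb2, hc2]
  field_simp
  unfold pE1 at h
  unfold detg
  linear_combination h

theorem codazzi2_of {L M N g11 g12 g22 : ℝ × ℝ × ℝ → ℝ} {q : ℝ × ℝ × ℝ} {k a1 b1 c1 a2 b2 c2 : ℝ}
    (hdet : 0 < detg g11 g12 g22 q)
    (h : pE2 k (L q) (M q) (N q) (g11 q) (g12 q) (g22 q) a1 b1 c1 a2 b2 c2 = 0)
    (ha1 : pdx1 g11 q = a1) (hb1 : pdx1 g12 q = b1) (hc1 : pdx1 g22 q = c1)
    (ha2 : pdx2 g11 q = a2) (hb2 : pdx2 g12 q = b2) (hc2 : pdx2 g22 q = c2) :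
    k = Gamma2_22 g11 g12 g22 q * L q - 2 * Gamma2_12 g11 g12 g22 q * M q
      + Gamma2_11 g11 g12 g22 q * N q := by
  have hd := hdet.ne'
  unfold Gamma2_22 Gamma2_12 Gamma2_11
  rw [ha1, hb1, hc1, ha2, hb2, hc2]
  field_simp
  unfold pE2 at h
  unfold detg
  linear_combination -h

theorem brioschi_of {g11 g12 g22 : ℝ × ℝ × ℝ → ℝ} {q : ℝ × ℝ × ℝ}
    {k a1 b1 c1 a2 b2 c2 a22 b12 c11 : ℝ}
    (hdet : 0 < detg g11 g12 g22 q)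
    (h : pG k (g11 q) (g12 q) (g22 q) a1 b1 c1 a2 b2 c2 a22 b12 c11 = 0)
    (ha1 : pdx1 g11 q = a1) (hb1 : pdx1 g12 q = b1) (hc1 : pdx1 g22 q = c1)
    (ha2 : pdx2 g11 q = a2) (hb2 : pdx2 g12 q = b2) (hc2 : pdx2 g22 q = c2)
    (ha22 : pdx2 (pdx2 g11) q = a22) (hb12 : pdx1 (pdx2 g12) q = b12)
    (hc11 : pdx1 (pdx1 g22) q = c11) :
    brioschi g11 g12 g22 q = k := by
  have hd := hdet.ne'
  unfold brioschi
  rw [ha22, hb12, hc11, ha1, hb1, hc1, ha2, hb2, hc2]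
  simp only [Matrix.det_fin_three, Matrix.of_apply, Matrix.cons_val', Matrix.cons_val_zero,
    Matrix.cons_val_one, Matrix.cons_val]
  field_simp
  unfold pG at h
  unfold detg
  linear_combination h / 2

theorem zero_of_deriv_zero {F : ℝ → ℝ} {x0 δ : ℝ} (h0 : F x0 = 0)
    (hF : ∀ x ∈ Metric.ball x0 δ, HasDerivAt F 0 x) {x : ℝ} (hx : x ∈ Metric.ball x0 δ) :
    F x = 0 := by
  have hδ : 0 < δ := lt_of_le_of_lt dist_nonneg (Metric.mem_ball.1 hx)
  rw [← h0]
  exact Metric.isOpen_ball.is_const_of_deriv_eq_zero (convex_ball x0 δ).isPreconnected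
    (fun y hy => (hF y hy).differentiableAt.differentiableWithinAt)
    (fun y hy => (hF y hy).deriv) hx (Metric.mem_ball_self hδ)

open CKA in
theorem ck_core (L M N κ : ℝ × ℝ × ℝ → ℝ) (q0 : ℝ × ℝ × ℝ)
    (hL : AnalyticAt ℝ L q0) (hM : AnalyticAt ℝ M q0) (hN : AnalyticAt ℝ N q0)
    (hκ : AnalyticAt ℝ κ q0) (hN0 : N q0 ≠ 0) :
    ∃ δ : ℝ, 0 < δ ∧ ∃ g11 g12 g22 : ℝ × ℝ × ℝ → ℝ, ∀ q ∈ Metric.ball q0 δ,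
      AnalyticAt ℝ g11 q ∧ AnalyticAt ℝ g12 q ∧ AnalyticAt ℝ g22 q ∧
      0 < detg g11 g12 g22 q ∧
      pdx1 N q - pdx2 M q =
        -(Gamma1_22 g11 g12 g22 q) * L q + 2 * Gamma1_12 g11 g12 g22 q * M q
          - Gamma1_11 g11 g12 g22 q * N q ∧
      pdx1 M q - pdx2 L q =
        Gamma2_22 g11 g12 g22 q * L q - 2 * Gamma2_12 g11 g12 g22 q * M q
          + Gamma2_11 g11 g12 g22 q * N q ∧
      brioschi g11 g12 g22 q = κ q := by
  set k1 : ℝ × ℝ × ℝ → ℝ := fun q => pdx1 N q - pdx2 M q with hk1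
  set k2 : ℝ × ℝ × ℝ → ℝ := fun q => pdx1 M q - pdx2 L q with hk2
  have ak1 : AnalyticAt ℝ k1 q0 := (pdx1_analytic hN).fun_sub (pdx2_analytic hM)
  have ak2 : AnalyticAt ℝ k2 q0 := (pdx1_analytic hM).fun_sub (pdx2_analytic hL)
  have aπ : AnalyticAt ℝ (fun q : ℝ × ℝ × ℝ => (q0.1, q.2)) q0 :=
    analyticAt_const.prod analyticAt_snd
  obtain ⟨β, hβ⟩ : ∃ β : ℝ × ℝ × ℝ → ℝ, β = fun q => -2 * k1 (q0.1, q.2) / N (q0.1, q.2) :=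
    ⟨_, rfl⟩
  obtain ⟨β', hβ'⟩ : ∃ β' : ℝ × ℝ × ℝ → ℝ, β' = fun q => k2 (q0.1, q.2) / N (q0.1, q.2) :=
    ⟨_, rfl⟩
  have aNπ : AnalyticAt ℝ (fun q : ℝ × ℝ × ℝ => N (q0.1, q.2)) q0 :=
    AnalyticAt.fun_comp (g := N) (f := fun q : ℝ × ℝ × ℝ => (q0.1, q.2)) hN aπ
  have aβ : AnalyticAt ℝ β q0 := by
    rw [hβ]
    exact (analyticAt_const.fun_mul (AnalyticAt.fun_comp (g := k1)
      (f := fun q : ℝ × ℝ × ℝ => (q0.1, q.2)) ak1 aπ)).fun_div aNπ hN0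
  have aβ' : AnalyticAt ℝ β' q0 := by
    rw [hβ']
    exact (AnalyticAt.fun_comp (g := k2)
      (f := fun q : ℝ × ℝ × ℝ => (q0.1, q.2)) ak2 aπ).fun_div aNπ hN0
  have iβ : ∀ x y w, β (x, w) = β (y, w) := fun x y w => by rw [hβ]
  have iβ' : ∀ x y w, β' (x, w) = β' (y, w) := fun x y w => by rw [hβ']
  have iβy : ∀ x y w, pdx2 β (x, w) = pdx2 β (y, w) := fun x y w => by rw [hβ]; rfl
  have iβy' : ∀ x y w, pdx2 β' (x, w) = pdx2 β' (y, w) := fun x y w => by rw [hβ']; rfl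
  have i0 : ∀ x y w, (0 : ℝ × ℝ × ℝ → ℝ) (x, w) = (0 : ℝ × ℝ × ℝ → ℝ) (y, w) :=
    fun x y w => rfl
  set f : Fin 16 → ℝ × ℝ × ℝ → ℝ := ![N, M, L, pdx1 N, pdx1 M, pdx1 L, k1, k2, pdx1 k1, pdx1 k2,
    κ, β, β', pdx2 β, pdx2 β', pdx2 (pdx2 β)] with hf
  have af : ∀ i, AnalyticAt ℝ (f i) q0 := by
    intro i
    fin_cases i
    · exact hN
    · exact hM
    · exact hL
    · exact pdx1_analytic hN
    · exact pdx1_analytic hM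
    · exact pdx1_analytic hL
    · exact ak1
    · exact ak2
    · exact pdx1_analytic ak1
    · exact pdx1_analytic ak2
    · exact hκ
    · exact aβ
    · exact aβ'
    · exact pdx2_analytic aβ
    · exact pdx2_analytic aβ'
    · exact pdx2_analytic (pdx2_analytic aβ)
  obtain ⟨s, hs, y, z, u, d, hFF, hd⟩ := ck_solve f q0 af hN0
  set g11 := A0 q0 s 1 β y with hg11
  set g12 := A0 q0 s 0 β' z with hg12
  set g22 := A0 q0 s 1 0 u with hg22
  have ag11 : AnalyticAt ℝ g11 q0 := A0_analytic q0 s y aβ 1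
  have ag12 : AnalyticAt ℝ g12 q0 := A0_analytic q0 s z aβ' 0
  have ag22 : AnalyticAt ℝ g22 q0 := A0_analytic q0 s u (β := 0) analyticAt_const 1
  have h0dom : (0 : ℝ × ℝ × ℝ) ∈ dom := by simp [dom]
  have hbase : ∀ k β Z, A0 q0 s k β Z q0 = k := fun k β Z => by
    simp [A0, Sc_base, E_J_zero (J Z) h0dom rfl]
  have hdet0 : 0 < detg g11 g12 g22 q0 := by
    simp [detg, hg11, hg12, hg22, hbase]
  have hdetc : ContinuousAt (detg g11 g12 g22) q0 := by
    have := ((ag11.fun_mul ag22).fun_sub (ag12.fun_pow 2)).continuousAt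
    exact this
  have hScc : ContinuousAt (Sc q0 s) q0 := (Sc_analytic q0 s q0).continuousAt
  have ev1 : ∀ᶠ q in nhds q0, Sc q0 s q ∈ dom :=
    hScc.eventually_mem (by rw [Sc_base]; exact dom_open.mem_nhds h0dom)
  have ev2 : ∀ᶠ q in nhds q0, ∀ i, AnalyticAt ℝ (f i) q :=
    Filter.eventually_all.2 fun i => (af i).eventually_analyticAt
  obtain ⟨δ, hδ, hball⟩ := Metric.eventually_nhds_iff_ball.1
    (ev1.and (ev2.and ((hN.continuousAt.eventually_ne hN0).and
      ((hdetc.eventually (lt_mem_nhds hdet0)).and (ag11.eventually_analyticAt.and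
        (ag12.eventually_analyticAt.and ag22.eventually_analyticAt))))))
  have hsc : ∀ q ∈ Metric.ball q0 δ, Sc q0 s q ∈ dom := fun q hq => (hball q hq).1
  have hfa : ∀ q ∈ Metric.ball q0 δ, ∀ i, AnalyticAt ℝ (f i) q := fun q hq => (hball q hq).2.1
  have hNn : ∀ q ∈ Metric.ball q0 δ, N q ≠ 0 := fun q hq => (hball q hq).2.2.1
  have hU : IsOpen (Metric.ball q0 δ) := Metric.isOpen_ball
  -- first derivatives of the metric
  have h1a : ∀ q ∈ Metric.ball q0 δ, pdx1 g11 q = A1 q0 s β y q := fun q hq =>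
    (A0_d1 q0 hs (hsc q hq) y iβ 1).deriv
  have h1b : ∀ q ∈ Metric.ball q0 δ, pdx1 g12 q = A1 q0 s β' z q := fun q hq =>
    (A0_d1 q0 hs (hsc q hq) z iβ' 0).deriv
  have h1c : ∀ q ∈ Metric.ball q0 δ, pdx1 g22 q = A1 q0 s 0 u q := fun q hq =>
    (A0_d1 q0 hs (hsc q hq) u i0 1).deriv
  have h2a : ∀ q ∈ Metric.ball q0 δ, pdx2 g11 q = A2 q0 s (pdx2 β) y q := fun q hq =>
    (A0_d2 q0 hs (hsc q hq) y (pdx2_hasDeriv (hfa q hq 11)) 1).deriv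
  have h2b : ∀ q ∈ Metric.ball q0 δ, pdx2 g12 q = A2 q0 s (pdx2 β') z q := fun q hq =>
    (A0_d2 q0 hs (hsc q hq) z (pdx2_hasDeriv (hfa q hq 12)) 0).deriv
  have h2c : ∀ q ∈ Metric.ball q0 δ, pdx2 g22 q = A2 q0 s 0 u q := fun q hq =>
    (A0_d2 q0 hs (hsc q hq) u (β := 0) (βy := 0) (hasDerivAt_const _ _) 1).deriv
  -- second derivatives of the metric
  have h22a : ∀ q ∈ Metric.ball q0 δ,
      pdx2 (pdx2 g11) q = A22 q0 s (pdx2 (pdx2 β)) y q := fun q hq => by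
    rw [pdx2_congr hU h2a hq]
    exact (A2_d2 q0 hs (hsc q hq) y (pdx2_hasDeriv (hfa q hq 13))).deriv
  have h12b : ∀ q ∈ Metric.ball q0 δ,
      pdx1 (pdx2 g12) q = A12 q0 s (pdx2 β') z q := fun q hq => by
    rw [pdx1_congr hU h2b hq]
    exact (A2_d1 q0 hs (hsc q hq) z iβy').deriv
  have h11c : ∀ q ∈ Metric.ball q0 δ,
      pdx1 (pdx1 g22) q = E u (Sc q0 s q) := fun q hq => by
    rw [pdx1_congr hU h1c hq]
    exact (A1_d1 q0 hs (hsc q hq) u i0).deriv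
  have hmem : ∀ q ∈ Metric.ball q0 δ, ∀ x ∈ Metric.ball q0.1 δ,
      ((x, q.2.1, q.2.2) : ℝ × ℝ × ℝ) ∈ Metric.ball q0 δ := fun q hq x hx => by
    rw [Metric.mem_ball, Prod.dist_eq, max_lt_iff] at hq ⊢
    exact ⟨hx, hq.2⟩
  -- values on the initial line
  have hA0l : ∀ q ∈ Metric.ball q0 δ, q.1 = q0.1 → ∀ k β Z, A0 q0 s k β Z q = k :=
    fun q hq h k β Z => by
      simp [A0, h, E_J_zero (J Z) (hsc q hq) (by simp [Sc, h])]
  have hA1l : ∀ q ∈ Metric.ball q0 δ, q.1 = q0.1 → ∀ β Z, A1 q0 s β Z q = β q :=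
    fun q hq h β Z => by
      simp [A1, E_J_zero Z (hsc q hq) (by simp [Sc, h])]
  have hA2l : ∀ q ∈ Metric.ball q0 δ, q.1 = q0.1 → ∀ β Z, A2 q0 s β Z q = 0 :=
    fun q hq h β Z => by
      simp [A2, h, E_J_zero (K Z) (hsc q hq) (by simp [Sc, h])]
  have hE1 : ∀ q ∈ Metric.ball q0 δ, pE1 (k1 q) (L q) (M q) (N q) (g11 q) (g12 q) (g22 q)
      (A1 q0 s β y q) (A1 q0 s β' z q) (A1 q0 s 0 u q)
      (A2 q0 s (pdx2 β) y q) (A2 q0 s (pdx2 β') z q) (A2 q0 s 0 u q) = 0 := by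
    intro q hq
    have hx : q.1 ∈ Metric.ball q0.1 δ := by
      rw [Metric.mem_ball, Prod.dist_eq, max_lt_iff] at hq
      exact hq.1
    refine zero_of_deriv_zero (F := fun x => pE1 (k1 (x, q.2.1, q.2.2)) (L (x, q.2.1, q.2.2))
      (M (x, q.2.1, q.2.2)) (N (x, q.2.1, q.2.2)) (g11 (x, q.2.1, q.2.2)) (g12 (x, q.2.1, q.2.2))
      (g22 (x, q.2.1, q.2.2)) (A1 q0 s β y (x, q.2.1, q.2.2)) (A1 q0 s β' z (x, q.2.1, q.2.2))
      (A1 q0 s 0 u (x, q.2.1, q.2.2)) (A2 q0 s (pdx2 β) y (x, q.2.1, q.2.2))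
      (A2 q0 s (pdx2 β') z (x, q.2.1, q.2.2)) (A2 q0 s 0 u (x, q.2.1, q.2.2))) ?_ ?_ hx
    · have hr := hmem q hq q0.1 (Metric.mem_ball_self hδ)
      have hn := hNn _ hr
      simp only [hg11, hg12, hg22, hA0l _ hr rfl, hA1l _ hr rfl, hA2l _ hr rfl]
      rw [hβ]
      simp only [pE1, Pi.zero_apply]
      field_simp
      ring
    · intro x hx
      have hr := hmem q hq x hx
      have hz := (FF_ev q0 hs f y z u d hFF hd (hsc _ hr)).1
      rw [← hz]
      exact hasDeriv_pE1 (pdx1_hasDeriv (hfa _ hr 6)) (pdx1_hasDeriv (hfa _ hr 2))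
        (pdx1_hasDeriv (hfa _ hr 1)) (pdx1_hasDeriv (hfa _ hr 0))
        (A0_d1 q0 hs (hsc _ hr) y iβ 1) (A0_d1 q0 hs (hsc _ hr) z iβ' 0)
        (A0_d1 q0 hs (hsc _ hr) u i0 1) (A1_d1 q0 hs (hsc _ hr) y iβ)
        (A1_d1 q0 hs (hsc _ hr) z iβ') (A1_d1 q0 hs (hsc _ hr) u i0)
        (A2_d1 q0 hs (hsc _ hr) y iβy) (A2_d1 q0 hs (hsc _ hr) z iβy')
        (A2_d1 q0 hs (hsc _ hr) u i0)
  have hE2 : ∀ q ∈ Metric.ball q0 δ, pE2 (k2 q) (L q) (M q) (N q) (g11 q) (g12 q) (g22 q)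
      (A1 q0 s β y q) (A1 q0 s β' z q) (A1 q0 s 0 u q)
      (A2 q0 s (pdx2 β) y q) (A2 q0 s (pdx2 β') z q) (A2 q0 s 0 u q) = 0 := by
    intro q hq
    have hx : q.1 ∈ Metric.ball q0.1 δ := by
      rw [Metric.mem_ball, Prod.dist_eq, max_lt_iff] at hq
      exact hq.1
    refine zero_of_deriv_zero (F := fun x => pE2 (k2 (x, q.2.1, q.2.2)) (L (x, q.2.1, q.2.2))
      (M (x, q.2.1, q.2.2)) (N (x, q.2.1, q.2.2)) (g11 (x, q.2.1, q.2.2)) (g12 (x, q.2.1, q.2.2))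
      (g22 (x, q.2.1, q.2.2)) (A1 q0 s β y (x, q.2.1, q.2.2)) (A1 q0 s β' z (x, q.2.1, q.2.2))
      (A1 q0 s 0 u (x, q.2.1, q.2.2)) (A2 q0 s (pdx2 β) y (x, q.2.1, q.2.2))
      (A2 q0 s (pdx2 β') z (x, q.2.1, q.2.2)) (A2 q0 s 0 u (x, q.2.1, q.2.2))) ?_ ?_ hx
    · have hr := hmem q hq q0.1 (Metric.mem_ball_self hδ)
      have hn := hNn _ hr
      simp only [hg11, hg12, hg22, hA0l _ hr rfl, hA1l _ hr rfl, hA2l _ hr rfl]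
      rw [hβ']
      simp only [pE2, Pi.zero_apply]
      field_simp
      ring
    · intro x hx
      have hr := hmem q hq x hx
      have hz := (FF_ev q0 hs f y z u d hFF hd (hsc _ hr)).2.1
      rw [← hz]
      exact hasDeriv_pE2 (pdx1_hasDeriv (hfa _ hr 7)) (pdx1_hasDeriv (hfa _ hr 2))
        (pdx1_hasDeriv (hfa _ hr 1)) (pdx1_hasDeriv (hfa _ hr 0))
        (A0_d1 q0 hs (hsc _ hr) y iβ 1) (A0_d1 q0 hs (hsc _ hr) z iβ' 0)
        (A0_d1 q0 hs (hsc _ hr) u i0 1) (A1_d1 q0 hs (hsc _ hr) y iβ)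
        (A1_d1 q0 hs (hsc _ hr) z iβ') (A1_d1 q0 hs (hsc _ hr) u i0)
        (A2_d1 q0 hs (hsc _ hr) y iβy) (A2_d1 q0 hs (hsc _ hr) z iβy')
        (A2_d1 q0 hs (hsc _ hr) u i0)
  refine ⟨δ, hδ, g11, g12, g22, fun q hq => ?_⟩
  obtain ⟨-, -, -, hdet, ha, hb, hc⟩ := hball q hq
  refine ⟨ha, hb, hc, hdet, ?_, ?_, ?_⟩
  · exact codazzi1_of hdet (hE1 q hq) (h1a q hq) (h1b q hq) (h1c q hq) (h2a q hq) (h2b q hq)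
      (h2c q hq)
  · exact codazzi2_of hdet (hE2 q hq) (h1a q hq) (h1b q hq) (h1c q hq) (h2a q hq) (h2b q hq)
      (h2c q hq)
  · exact brioschi_of hdet (FF_ev q0 hs f y z u d hFF hd (hsc _ hq)).2.2 (h1a q hq) (h1b q hq)
      (h1c q hq) (h2a q hq) (h2b q hq) (h2c q hq) (h22a q hq) (h12b q hq) (h11c q hq)

/-- Corollary 8.1: an analytic local solution `(ρ, u, v)` of the compressible Euler
equations with pressure `p = ρ^γ/γ` and `ρ(x₀,0)u(x₀,0)v(x₀,0) ≠ 0` defines a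
time-evolving metric `g` (analytic, with `det g > 0`) satisfying the Gauss–Codazzi
equations with `L = ρv² + p`, `M = −ρuv`, `N = ρu² + p`; in particular the Gauss
curvature equals `κ = p² + pρ(u² + v²)`. -/
theorem statement16 (γ : ℝ) (hγ : 1 ≤ γ)
    (W : Set (ℝ × ℝ)) (hW : IsOpen W) (T : ℝ) (hT : 0 < T)
    (ρ u v : ℝ × ℝ × ℝ → ℝ)
    (D : Set (ℝ × ℝ × ℝ))
    (hD : D = {q : ℝ × ℝ × ℝ | (q.1, q.2.1) ∈ W ∧ q.2.2 ∈ Set.Ioo (-T) T})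
    (hρ : AnalyticOnNhd ℝ ρ D) (hu : AnalyticOnNhd ℝ u D) (hv : AnalyticOnNhd ℝ v D)
    (hρpos : ∀ q ∈ D, 0 < ρ q)
    (p : ℝ × ℝ × ℝ → ℝ) (hp : p = fun q => ρ q ^ γ / γ)
    (hmom1 : ∀ q ∈ D,
      pdx1 (fun r => ρ r * (u r) ^ 2 + p r) q + pdx2 (fun r => ρ r * u r * v r) q
      = -(pdt (fun r => ρ r * u r) q))
    (hmom2 : ∀ q ∈ D,
      pdx1 (fun r => ρ r * u r * v r) q + pdx2 (fun r => ρ r * (v r) ^ 2 + p r) q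
      = -(pdt (fun r => ρ r * v r) q))
    (hmass : ∀ q ∈ D,
      pdx1 (fun r => ρ r * u r) q + pdx2 (fun r => ρ r * v r) q = -(pdt ρ q))
    (x₀ : ℝ × ℝ) (hx₀ : x₀ ∈ W)
    (hne : ρ (x₀.1, x₀.2, 0) * u (x₀.1, x₀.2, 0) * v (x₀.1, x₀.2, 0) ≠ 0) :
    ∃ (W' : Set (ℝ × ℝ)) (T' : ℝ), IsOpen W' ∧ x₀ ∈ W' ∧ W' ⊆ W ∧ 0 < T' ∧ T' ≤ T ∧
    ∃ g11 g12 g22 : ℝ × ℝ × ℝ → ℝ, ∃ D' : Set (ℝ × ℝ × ℝ),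
      D' = {q : ℝ × ℝ × ℝ | (q.1, q.2.1) ∈ W' ∧ q.2.2 ∈ Set.Ioo (-T') T'} ∧
      AnalyticOnNhd ℝ g11 D' ∧ AnalyticOnNhd ℝ g12 D' ∧ AnalyticOnNhd ℝ g22 D' ∧
      (∀ q ∈ D', 0 < detg g11 g12 g22 q) ∧
      (∀ q ∈ D', GaussCodazzi (fun r => ρ r * (v r) ^ 2 + p r)
        (fun r => -(ρ r * u r * v r)) (fun r => ρ r * (u r) ^ 2 + p r) g11 g12 g22 q) ∧
      (∀ q ∈ D', brioschi g11 g12 g22 q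
        = (p q) ^ 2 + p q * ρ q * ((u q) ^ 2 + (v q) ^ 2)) := by
  set q0 : ℝ × ℝ × ℝ := (x₀.1, x₀.2, 0) with hq0
  have hq0D : q0 ∈ D := by
    rw [hD]
    exact ⟨hx₀, neg_lt_zero.2 hT, hT⟩
  have hγ0 : 0 < γ := lt_of_lt_of_le one_pos hγ
  have aρ := hρ q0 hq0D
  have au := hu q0 hq0D
  have av := hv q0 hq0D
  have pρ := hρpos q0 hq0D
  have ap : AnalyticAt ℝ p q0 := by
    rw [hp]
    have h1 : AnalyticAt ℝ (fun q => Real.exp (Real.log (ρ q) * γ)) q0 :=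
      ((AnalyticAt.fun_comp (g := Real.log) (analyticAt_log pρ) aρ).fun_mul analyticAt_const).rexp'
    have h2 : AnalyticAt ℝ (fun q => ρ q ^ γ) q0 := by
      refine h1.congr ?_
      filter_upwards [aρ.continuousAt.eventually (lt_mem_nhds pρ)] with r hr
      exact (Real.rpow_def_of_pos hr γ).symm
    exact h2.fun_div analyticAt_const hγ0.ne'
  have hpp : 0 < p q0 := by
    rw [hp]
    exact div_pos (Real.rpow_pos_of_pos pρ γ) hγ0
  have aL : AnalyticAt ℝ (fun r => ρ r * (v r) ^ 2 + p r) q0 :=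
    (aρ.fun_mul (av.fun_pow 2)).fun_add ap
  have aM : AnalyticAt ℝ (fun r => -(ρ r * u r * v r)) q0 :=
    ((aρ.fun_mul au).fun_mul av).fun_neg
  have aN : AnalyticAt ℝ (fun r => ρ r * (u r) ^ 2 + p r) q0 :=
    (aρ.fun_mul (au.fun_pow 2)).fun_add ap
  have aκ : AnalyticAt ℝ (fun q => (p q) ^ 2 + p q * ρ q * ((u q) ^ 2 + (v q) ^ 2)) q0 :=
    (ap.fun_pow 2).fun_add ((ap.fun_mul aρ).fun_mul ((au.fun_pow 2).fun_add (av.fun_pow 2)))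
  have hN0 : ρ q0 * (u q0) ^ 2 + p q0 ≠ 0 := by positivity
  obtain ⟨δ, hδ, g11, g12, g22, hg⟩ := ck_core _ _ _ _ q0 aL aM aN aκ hN0
  obtain ⟨ε, hε, hεW⟩ := Metric.isOpen_iff.1 hW x₀ hx₀
  have hsub : ∀ q : ℝ × ℝ × ℝ, (q.1, q.2.1) ∈ Metric.ball x₀ (min ε δ) →
      q.2.2 ∈ Set.Ioo (-(min δ T)) (min δ T) → q ∈ Metric.ball q0 δ := by
    intro q h1 h2
    have h1' := (lt_min_iff.1 (Metric.mem_ball.1 h1)).2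
    rw [Prod.dist_eq, max_lt_iff] at h1'
    have h2' := lt_of_lt_of_le (abs_lt.2 h2) (min_le_left δ T)
    rw [Metric.mem_ball, Prod.dist_eq, Prod.dist_eq, max_lt_iff, max_lt_iff]
    refine ⟨h1'.1, h1'.2, ?_⟩
    simpa [hq0, Real.dist_eq] using h2'
  refine ⟨Metric.ball x₀ (min ε δ), min δ T, Metric.isOpen_ball,
    Metric.mem_ball_self (lt_min hε hδ),
    (Metric.ball_subset_ball (min_le_left _ _)).trans hεW, lt_min hδ hT, min_le_right _ _,
    g11, g12, g22, _, rfl, ?_, ?_, ?_, ?_, ?_, ?_⟩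
  · exact fun q hq => (hg q (hsub q hq.1 hq.2)).1
  · exact fun q hq => (hg q (hsub q hq.1 hq.2)).2.1
  · exact fun q hq => (hg q (hsub q hq.1 hq.2)).2.2.1
  · exact fun q hq => (hg q (hsub q hq.1 hq.2)).2.2.2.1
  · intro q hq
    obtain ⟨-, -, -, -, h1, h2, h3⟩ := hg q (hsub q hq.1 hq.2)
    refine ⟨h1, h2, ?_⟩
    rw [h3]
    ring
  · exact fun q hq => (hg q (hsub q hq.1 hq.2)).2.2.2.2.2.2
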